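/- arXiv:2503.14176 — 2 statements merged into one kernel-verified Lean document; each statement's English description precedes it below -/
import Mathlib

section
/- Let 1 ≤ a < b be fixed positive integers with gcd(a,b) = 1, and fix A > 0. Define c₁(a,b) = a^{b/(2(a+b))} b^{a/(2(a+b))} (a+b)^{−1/2}, c₂(a,b) = (a/b)^{b/(a+b)} + (b/a)^{a/(a+b)}, and for H ≥ 2 let Δ*_{a,b}(x, H) = (c₁(a,b)/π) x^{1/(2(a+b))} Σ_{1 ≤ h ≤ aH} Σ_{1 ≤ r ≤ bH} h^{−(a+2b)/(2(a+b))} r^{−(2a+b)/(2(a+b))} cos( 2π c₂(a,b) x^{1/(a+b)} (h^a r^b)^{1/(a+b)} − π/4 ). Then for all T ≥ 10, 0 < T₀ ≤ T and 2 ≤ H ≤ T^A, ∫_T^{T+T₀} Δ*_{a,b}(x, H)² dx = (c₁(a,b)²/(2π²)) G_{a,b} ∫_T^{T+T₀} x^{1/(a+b)} dx + O( T^{1+1/(a+b)} H^{−a/(2(a+b))} log²T + T^{1+1/(a+b) − a/(b(a+b)(a+b−1))} (log T)⁴ ), with implied constant depending only on a, b, A. -/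
open Real MeasureTheory

/-- `c₁(a,b) = a^{b/(2(a+b))} b^{a/(2(a+b))} (a+b)^{-1/2}`. -/
noncomputable def c1 (a b : ℝ) : ℝ :=
  a ^ (b / (2 * (a + b))) * b ^ (a / (2 * (a + b))) * (a + b) ^ (-(1 : ℝ) / 2)

/-- `c₂(a,b) = (a/b)^{b/(a+b)} + (b/a)^{a/(a+b)}`. -/
noncomputable def c2 (a b : ℝ) : ℝ :=
  (a / b) ^ (b / (a + b)) + (b / a) ^ (a / (a + b))

/-- The truncated Voronoi-type sum `Δ*_{a,b}(x, H)`. -/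
noncomputable def DeltaStar (a b H x : ℝ) : ℝ :=
  (c1 a b / π) * x ^ (1 / (2 * (a + b))) *
    ∑ h ∈ Finset.Icc 1 ⌊a * H⌋₊, ∑ r ∈ Finset.Icc 1 ⌊b * H⌋₊,
      (h : ℝ) ^ (-(a + 2 * b) / (2 * (a + b))) * (r : ℝ) ^ (-(2 * a + b) / (2 * (a + b))) *
        Real.cos (2 * π * c2 a b * x ^ (1 / (a + b)) *
          ((h : ℝ) ^ a * (r : ℝ) ^ b) ^ (1 / (a + b)) - π / 4)

open Classical in
/-- The singular series `G_{a,b}`, summed over quadruples `(h₁, h₂, r₁, r₂)` of positive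
integers with `h₁^a r₁^b = h₂^a r₂^b`. -/
noncomputable def Gab (a b : ℝ) : ℝ :=
  ∑' q : ℕ+ × ℕ+ × ℕ+ × ℕ+,
    if (q.1 : ℝ) ^ a * (q.2.2.1 : ℝ) ^ b = (q.2.1 : ℝ) ^ a * (q.2.2.2 : ℝ) ^ b then
      ((q.1 : ℝ) * (q.2.1 : ℝ)) ^ (-(a + 2 * b) / (2 * (a + b))) *
        ((q.2.2.1 : ℝ) * (q.2.2.2 : ℝ)) ^ (-(2 * a + b) / (2 * (a + b)))
    else 0


lemma log_sep_aux (A B : ℕ) (hB : 1 ≤ B) (h : B < A) :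
    1 / (2 * √((A:ℝ) * B)) ≤ Real.log A - Real.log B := by
  have hB' : (1:ℝ) ≤ B := by exact_mod_cast hB
  have hA' : (B:ℝ) + 1 ≤ A := by exact_mod_cast h
  have hA0 : (0:ℝ) < A := by linarith
  have hB0 : (0:ℝ) < B := by linarith
  have h1 : 1 - (B:ℝ) / A ≤ Real.log A - Real.log B := by
    have := Real.one_sub_inv_le_log_of_pos (x := (A:ℝ)/B) (by positivity)
    rw [Real.log_div hA0.ne' hB0.ne', inv_div] at this
    exact this
  refine le_trans ?_ h1
  have hs : 1 ≤ √((A:ℝ)*B) := Real.one_le_sqrt.mpr (by nlinarith)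
  rcases le_or_gt (A:ℝ) (2*B) with hc | hc
  · have h2 : (A:ℝ) ≤ 2 * √((A:ℝ)*B) := by
      have : √((A:ℝ)*B) ≥ A/2 := Real.le_sqrt_of_sq_le (by nlinarith)
      linarith
    have : 1 / (2 * √((A:ℝ) * B)) ≤ 1 / A := one_div_le_one_div_of_le hA0 h2
    refine this.trans ?_
    rw [le_sub_iff_add_le, ← add_div, div_le_one hA0]; linarith
  · have h3 : (B:ℝ)/A ≤ 1/2 := by rw [div_le_iff₀ hA0]; linarith
    have : 1 / (2 * √((A:ℝ) * B)) ≤ 1 / 2 := one_div_le_one_div_of_le (by norm_num) (by linarith)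
    linarith

lemma log_sep (A B : ℕ) (hA : 1 ≤ A) (hB : 1 ≤ B) (h : A ≠ B) :
    1 / (2 * √((A:ℝ) * B)) ≤ |Real.log A - Real.log B| := by
  rcases lt_or_gt_of_ne h with h | h
  · rw [abs_sub_comm, mul_comm (A:ℝ)]
    exact (log_sep_aux B A hA h).trans (le_abs_self _)
  · exact (log_sep_aux A B hB h).trans (le_abs_self _)

lemma harm_le (N : ℕ) : ∑ k ∈ Finset.Icc 1 N, 1 / (k:ℝ) ≤ 1 + Real.log N := by
  have := harmonic_le_one_add_log N
  rw [harmonic_eq_sum_Icc] at this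
  push_cast at this
  simpa using this

lemma sep_sum_one {ι : Type*} (F : Finset ι) (u t : ι → ℝ) (δ M : ℝ) (N : ℕ) (hδ : 0 < δ)
    (hM : 0 ≤ M) (hu : ∀ y ∈ F, 0 ≤ u y) (huN : ∀ y ∈ F, u y ≤ δ * N)
    (hsep : ∀ y ∈ F, ∀ y' ∈ F, y ≠ y' → δ ≤ |u y - u y'|)
    (htM : ∀ y ∈ F, t y ≤ M) (htu : ∀ y ∈ F, t y * u y ≤ 1) :
    ∑ y ∈ F, t y ≤ M + 1 / δ * (1 + Real.log N) := by
  classical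
  set φ : ℕ → ℝ := fun k => if k = 0 then M else 1 / δ * (1 / (k:ℝ)) with hφ
  have hφ0 : ∀ k, 0 ≤ φ k := by
    intro k; simp only [hφ]; split_ifs
    · exact hM
    · positivity
  set e : ι → ℕ := fun y => ⌊u y / δ⌋₊ with he
  have hinj : Set.InjOn e F := by
    intro y hy y' hy' hee
    by_contra hne
    have h1 := hsep y hy y' hy' hne
    have a1 := Nat.floor_le (div_nonneg (hu y hy) hδ.le)
    have a2 := Nat.lt_floor_add_one (u y / δ)
    have b1 := Nat.floor_le (div_nonneg (hu y' hy') hδ.le)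
    have b2 := Nat.lt_floor_add_one (u y' / δ)
    simp only [he] at hee
    rw [hee] at a1 a2
    rw [le_div_iff₀ hδ] at a1 b1
    rw [div_lt_iff₀ hδ] at a2 b2
    have : |u y - u y'| < δ := by rw [abs_lt]; constructor <;> nlinarith
    linarith
  have h1 : ∑ y ∈ F, t y ≤ ∑ y ∈ F, φ (e y) := by
    refine Finset.sum_le_sum fun y hy => ?_
    simp only [hφ]
    split_ifs with h0
    · exact htM y hy
    · have hpos : (0:ℝ) < e y := by exact_mod_cast Nat.pos_of_ne_zero h0
      have a1 := Nat.floor_le (div_nonneg (hu y hy) hδ.le)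
      rw [le_div_iff₀ hδ] at a1
      have hup : 0 < u y := lt_of_lt_of_le (by positivity) a1
      have : t y ≤ 1 / u y := by rw [le_div_iff₀ hup]; exact htu y hy
      refine this.trans ?_
      rw [one_div_mul_one_div_rev]
      exact one_div_le_one_div_of_le (by positivity) a1
  have h2 : ∑ y ∈ F, φ (e y) = ∑ k ∈ F.image e, φ k := by
    rw [Finset.sum_image hinj]
  have h3 : F.image e ⊆ insert 0 (Finset.Icc 1 N) := by
    intro k hk
    obtain ⟨y, hy, rfl⟩ := Finset.mem_image.mp hk
    have : e y ≤ N := by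
      apply Nat.floor_le_of_le
      rw [div_le_iff₀ hδ, mul_comm]; exact huN y hy
    simp only [Finset.mem_insert, Finset.mem_Icc]; omega
  have h4 : ∑ k ∈ F.image e, φ k ≤ ∑ k ∈ insert 0 (Finset.Icc 1 N), φ k :=
    Finset.sum_le_sum_of_subset_of_nonneg h3 fun k _ _ => hφ0 k
  have h5 : ∑ k ∈ insert 0 (Finset.Icc 1 N), φ k ≤ M + 1 / δ * (1 + Real.log N) := by
    rw [Finset.sum_insert (by simp)]
    have : ∑ k ∈ Finset.Icc 1 N, φ k = 1 / δ * ∑ k ∈ Finset.Icc 1 N, 1 / (k:ℝ) := by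
      rw [Finset.mul_sum]
      refine Finset.sum_congr rfl fun k hk => ?_
      have : k ≠ 0 := by have := Finset.mem_Icc.mp hk; omega
      simp [hφ, this]
    rw [this]
    have h6 := harm_le N
    have : φ 0 = M := by simp [hφ]
    rw [this]
    gcongr
  linarith

lemma sep_sum {ι : Type*} (F : Finset ι) (u t : ι → ℝ) (δ M : ℝ) (N : ℕ) (hδ : 0 < δ)
    (hM : 0 ≤ M) (huN : ∀ y ∈ F, |u y| ≤ δ * N)
    (hsep : ∀ y ∈ F, ∀ y' ∈ F, y ≠ y' → δ ≤ |u y - u y'|)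
    (htM : ∀ y ∈ F, t y ≤ M) (htu : ∀ y ∈ F, t y * |u y| ≤ 1) :
    ∑ y ∈ F, t y ≤ 2 * (M + 1 / δ * (1 + Real.log N)) := by
  classical
  rw [← Finset.sum_filter_add_sum_filter_not F (fun y => 0 ≤ u y)]
  have h1 := sep_sum_one (F.filter (fun y => 0 ≤ u y)) u t δ M N hδ hM
    (fun y hy => (Finset.mem_filter.mp hy).2)
    (fun y hy => (le_abs_self _).trans (huN y (Finset.mem_filter.mp hy).1))
    (fun y hy y' hy' => hsep y (Finset.mem_filter.mp hy).1 y' (Finset.mem_filter.mp hy').1)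
    (fun y hy => htM y (Finset.mem_filter.mp hy).1)
    (fun y hy => by
      have := htu y (Finset.mem_filter.mp hy).1
      rwa [abs_of_nonneg (Finset.mem_filter.mp hy).2] at this)
  have h2 := sep_sum_one (F.filter (fun y => ¬ 0 ≤ u y)) (fun y => - u y) t δ M N hδ hM
    (fun y hy => by have := (Finset.mem_filter.mp hy).2; push Not at this; linarith)
    (fun y hy => (neg_le_abs _).trans (huN y (Finset.mem_filter.mp hy).1))
    (fun y hy y' hy' hne => by
      have := hsep y (Finset.mem_filter.mp hy).1 y' (Finset.mem_filter.mp hy').1 hne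
      rw [show - u y - - u y' = -(u y - u y') by ring, abs_neg]; exact this)
    (fun y hy => htM y (Finset.mem_filter.mp hy).1)
    (fun y hy => by
      have := htu y (Finset.mem_filter.mp hy).1
      have h0 := (Finset.mem_filter.mp hy).2; push Not at h0
      rwa [abs_of_neg h0] at this)
  linarith


noncomputable def LL (a b : ℕ) (x y : ℕ × ℕ) : ℝ :=
  a * (Real.log x.1 - Real.log x.2) + b * (Real.log y.1 - Real.log y.2)

noncomputable def MM (a b : ℕ) (V : ℝ) (x y : ℕ × ℕ) : ℝ :=
  min (V * ((((x.1 : ℝ) * x.2) ^ a * ((y.1 : ℝ) * y.2) ^ b) ^ (1 / (2 * ((a : ℝ) + b)))))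
    (1 / |LL a b x y|)

noncomputable def EE (a b : ℕ) (V : ℝ) (x y : ℕ × ℕ) : ℝ :=
  1 / ((x.1 : ℝ) * x.2) * (1 / ((y.1 : ℝ) * y.2)) * MM a b V x y

def Sq (K : ℕ) : Finset (ℕ × ℕ) := Finset.Icc 1 K ×ˢ Finset.Icc 1 K

def Fr (K : ℕ) : Finset (ℕ × ℕ) := (Sq K).filter (fun x => Nat.Coprime x.1 x.2)

lemma mem_Sq {K : ℕ} {x : ℕ × ℕ} :
    x ∈ Sq K ↔ (1 ≤ x.1 ∧ x.1 ≤ K) ∧ (1 ≤ x.2 ∧ x.2 ≤ K) := by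
  simp [Sq, Finset.mem_product]

lemma mem_Fr {K : ℕ} {x : ℕ × ℕ} :
    x ∈ Fr K ↔ ((1 ≤ x.1 ∧ x.1 ≤ K) ∧ (1 ≤ x.2 ∧ x.2 ≤ K)) ∧ Nat.Coprime x.1 x.2 := by
  simp [Fr, mem_Sq]

lemma MM_nonneg (a b : ℕ) (V : ℝ) (hV : 0 ≤ V) (x y : ℕ × ℕ) : 0 ≤ MM a b V x y := by
  unfold MM; positivity

lemma EE_nonneg (a b : ℕ) (V : ℝ) (hV : 0 ≤ V) (x y : ℕ × ℕ) : 0 ≤ EE a b V x y := by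
  have := MM_nonneg a b V hV x y
  unfold EE; positivity

lemma frac_ne {y y' : ℕ × ℕ} (h : Nat.Coprime y.1 y.2) (h' : Nat.Coprime y'.1 y'.2)
    (hne : y ≠ y') : y.1 * y'.2 ≠ y'.1 * y.2 := by
  intro he
  apply hne
  have e1 : y.1 = y'.1 := by
    apply Nat.dvd_antisymm
    · exact h.dvd_of_dvd_mul_right (he ▸ Dvd.intro _ rfl)
    · exact h'.dvd_of_dvd_mul_right (he.symm ▸ Dvd.intro _ rfl)
  have e2 : y.2 = y'.2 := by
    apply Nat.dvd_antisymm
    · exact h.symm.dvd_of_dvd_mul_left (he.symm ▸ Dvd.intro_left _ rfl)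
    · exact h'.symm.dvd_of_dvd_mul_left (he ▸ Dvd.intro_left _ rfl)
  exact Prod.ext e1 e2

lemma inv_LL_le (a b : ℕ) (x y : ℕ × ℕ) (hx1 : 1 ≤ x.1) (hx2 : 1 ≤ x.2) (hy1 : 1 ≤ y.1)
    (hy2 : 1 ≤ y.2) :
    1 / |LL a b x y| ≤ 2 * √(((x.1 : ℝ) * x.2) ^ a * ((y.1 : ℝ) * y.2) ^ b) := by
  have p1 : (0:ℝ) < x.1 := by exact_mod_cast hx1
  have p2 : (0:ℝ) < x.2 := by exact_mod_cast hx2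
  have p3 : (0:ℝ) < y.1 := by exact_mod_cast hy1
  have p4 : (0:ℝ) < y.2 := by exact_mod_cast hy2
  have hL : LL a b x y = Real.log ((x.1 ^ a * y.1 ^ b : ℕ) : ℝ)
      - Real.log ((x.2 ^ a * y.2 ^ b : ℕ) : ℝ) := by
    push_cast
    rw [Real.log_mul (by positivity) (by positivity), Real.log_mul (by positivity) (by positivity),
      Real.log_pow, Real.log_pow, Real.log_pow, Real.log_pow]
    unfold LL; ring
  by_cases h0 : x.1 ^ a * y.1 ^ b = x.2 ^ a * y.2 ^ b
  · rw [hL, h0]; simp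
  · have := log_sep _ _ (Nat.one_le_iff_ne_zero.mpr (by positivity))
      (Nat.one_le_iff_ne_zero.mpr (by positivity)) h0
    rw [← hL] at this
    rw [show (((x.1 ^ a * y.1 ^ b : ℕ) : ℝ) * ((x.2 ^ a * y.2 ^ b : ℕ) : ℝ)) =
      ((x.1 : ℝ) * x.2) ^ a * ((y.1 : ℝ) * y.2) ^ b by push_cast; ring] at this
    have := one_div_le_one_div_of_le (by positivity) this
    rwa [one_div_one_div] at this

lemma min_le_pow (V W : ℝ) (s : ℕ) (hs : 3 ≤ s) (hV : 0 < V) (hW : 0 < W) :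
    min (V * √W) (2 * √(W ^ s)) ≤ 2 * W * V ^ (((s:ℝ) - 2) / (s - 1)) := by
  have hs' : (3:ℝ) ≤ s := by exact_mod_cast hs
  have hs1 : (0:ℝ) < (s:ℝ) - 1 := by linarith
  have e1 : √W = W * W ^ (-(1:ℝ)/2) := by
    rw [Real.sqrt_eq_rpow]; nth_rw 2 [← Real.rpow_one W]; rw [← Real.rpow_add hW]; norm_num
  have e2 : √(W^s) = W * W ^ (((s:ℝ) - 2)/2) := by
    rw [Real.sqrt_eq_rpow, ← Real.rpow_natCast, ← Real.rpow_mul hW.le]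
    nth_rw 2 [← Real.rpow_one W]; rw [← Real.rpow_add hW]; congr 1; ring
  rcases le_total W (V ^ (2 / ((s:ℝ) - 1))) with h | h
  · refine (min_le_right _ _).trans ?_
    rw [e2, ← mul_assoc]
    gcongr
    calc W ^ (((s:ℝ) - 2)/2) ≤ (V ^ (2 / ((s:ℝ) - 1))) ^ (((s:ℝ) - 2)/2) :=
          Real.rpow_le_rpow hW.le h (by linarith)
      _ = _ := by rw [← Real.rpow_mul hV.le]; congr 1; field_simp
  · refine (min_le_left _ _).trans ?_
    have h2 : W ^ (-(1:ℝ)/2) ≤ (V ^ (2 / ((s:ℝ) - 1))) ^ (-(1:ℝ)/2) :=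
      Real.rpow_le_rpow_of_nonpos (by positivity) h (by norm_num)
    have h3 : V * (V ^ (2 / ((s:ℝ) - 1))) ^ (-(1:ℝ)/2) = V ^ (((s:ℝ) - 2) / (s - 1)) := by
      rw [← Real.rpow_mul hV.le]; nth_rw 1 [← Real.rpow_one V]; rw [← Real.rpow_add hV]
      congr 1; field_simp; ring
    rw [e1]
    calc V * (W * W ^ (-(1:ℝ)/2)) ≤ V * (W * (V ^ (2 / ((s:ℝ) - 1))) ^ (-(1:ℝ)/2)) := by gcongr
      _ = W * (V * (V ^ (2 / ((s:ℝ) - 1))) ^ (-(1:ℝ)/2)) := by ring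
      _ = W * V ^ (((s:ℝ) - 2) / (s - 1)) := by rw [h3]
      _ ≤ 2 * W * V ^ (((s:ℝ) - 2) / (s - 1)) := by
        have : 0 ≤ W * V ^ (((s:ℝ) - 2) / (s - 1)) := by positivity
        linarith

lemma class_sum (a b K j : ℕ) (ha : 1 ≤ a) (hb : 1 ≤ b) (hs : 3 ≤ a + b) (V : ℝ) (hV : 0 < V)
    (x : ℕ × ℕ) (hx : x ∈ Fr K) (F : Finset (ℕ × ℕ)) (hF : ∀ y ∈ F, y ∈ Fr K)
    (hxy : ∀ y ∈ F, x.1 * x.2 ≤ y.1 * y.2) (hj1 : ∀ y ∈ F, 2 ^ j ≤ y.1 * y.2)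
    (hj2 : ∀ y ∈ F, y.1 * y.2 < 2 ^ (j + 1)) :
    ∑ y ∈ F, (1 / ((y.1 : ℝ) * y.2)) * MM a b V x y ≤
      8 * V ^ ((((a + b : ℕ):ℝ) - 2) / (((a + b : ℕ):ℝ) - 1)) +
        8 * (1 + Real.log ((4 * (a + b) * K ^ 3 : ℕ))) := by
  rcases F.eq_empty_or_nonempty with rfl | ⟨y₀, hy₀⟩
  · have hK : 1 ≤ K := by have := mem_Fr.mp hx; omega
    have : 0 ≤ Real.log ((4 * (a + b) * K ^ 3 : ℕ)) := Real.log_natCast_nonneg _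
    simp only [Finset.sum_empty]; positivity
  have hK : 1 ≤ K := by have := mem_Fr.mp hx; omega
  set W : ℝ := 2 ^ (j + 1) with hW
  have hW0 : 0 < W := by positivity
  set δ : ℝ := 1 / (2 * W) with hδ
  set M : ℝ := min (V * √W) (2 * √(W ^ (a + b))) with hM
  obtain ⟨⟨hx1, hx1K⟩, ⟨hx2, hx2K⟩⟩ := (mem_Fr.mp hx).1
  have hYW : ∀ y ∈ F, (y.1:ℝ) * y.2 ≤ W := by
    intro y hy; have := (hj2 y hy).le; rw [hW]; exact_mod_cast this
  have hXW : (x.1:ℝ) * x.2 ≤ W := by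
    have := (hxy y₀ hy₀).trans (hj2 y₀ hy₀).le; rw [hW]; exact_mod_cast this
  have hjK : (2:ℝ) ^ j ≤ (K:ℝ) ^ 2 := by
    have h1 := hj1 y₀ hy₀
    have h2 := (mem_Fr.mp (hF y₀ hy₀)).1
    have : 2 ^ j ≤ K ^ 2 := h1.trans (by rw [pow_two]; exact Nat.mul_le_mul h2.1.2 h2.2.2)
    exact_mod_cast this
  have hXY : ∀ y ∈ F, ((x.1 : ℝ) * x.2) ^ a * ((y.1 : ℝ) * y.2) ^ b ≤ W ^ (a + b) := by
    intro y hy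
    have := hYW y hy
    rw [pow_add]; gcongr
  have key : ∑ y ∈ F, MM a b V x y ≤
      2 * (M + 1 / δ * (1 + Real.log ((4 * (a + b) * K ^ 3 : ℕ)))) := by
    apply sep_sum F (fun y => LL a b x y)
    · positivity
    · positivity
    · intro y hy
      obtain ⟨⟨hy1, hy1K⟩, ⟨hy2, hy2K⟩⟩ := (mem_Fr.mp (hF y hy)).1
      have lg : ∀ n : ℕ, 1 ≤ n → n ≤ K → 0 ≤ Real.log n ∧ Real.log n ≤ K := by
        intro n h1 h2
        refine ⟨Real.log_natCast_nonneg n, ?_⟩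
        have : (n:ℝ) ≤ K := by exact_mod_cast h2
        exact (Real.log_le_self (by positivity)).trans this
      have ab : ∀ n m : ℕ, 1 ≤ n → n ≤ K → 1 ≤ m → m ≤ K → |Real.log n - Real.log m| ≤ K := by
        intro n m h1 h2 h3 h4
        have := lg n h1 h2
        have := lg m h3 h4
        rw [abs_le]; constructor <;> linarith
      have h1 : |LL a b x y| ≤ a * K + b * K := by
        unfold LL
        refine (abs_add_le _ _).trans ?_
        rw [abs_mul, abs_mul, Nat.abs_cast, Nat.abs_cast]
        have := ab _ _ hx1 hx1K hx2 hx2K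
        have := ab _ _ hy1 hy1K hy2 hy2K
        gcongr
      refine h1.trans ?_
      rw [hδ, hW, pow_succ]
      push_cast
      rw [div_mul_eq_mul_div, le_div_iff₀ (by positivity)]
      have : ((a:ℝ) * K + b * K) * (2 * (2 ^ j * 2)) ≤ ((a:ℝ) * K + b * K) * (2 * (K ^ 2 * 2)) := by
        gcongr
      refine this.trans (le_of_eq (by ring))
    · intro y hy y' hy' hne
      have c1 := (mem_Fr.mp (hF y hy))
      have c2 := (mem_Fr.mp (hF y' hy'))
      obtain ⟨⟨⟨hy1, -⟩, ⟨hy2, -⟩⟩, hc⟩ := c1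
      obtain ⟨⟨⟨hy1', -⟩, ⟨hy2', -⟩⟩, hc'⟩ := c2
      have p1 : (0:ℝ) < y.1 := by exact_mod_cast hy1
      have p2 : (0:ℝ) < y.2 := by exact_mod_cast hy2
      have p3 : (0:ℝ) < y'.1 := by exact_mod_cast hy1'
      have p4 : (0:ℝ) < y'.2 := by exact_mod_cast hy2'
      have h1 := log_sep _ _ (Nat.one_le_iff_ne_zero.mpr (by positivity))
        (Nat.one_le_iff_ne_zero.mpr (by positivity)) (frac_ne hc hc' hne)
      have h2 : LL a b x y - LL a b x y' =
          b * (Real.log ((y.1 * y'.2 : ℕ) : ℝ) - Real.log ((y'.1 * y.2 : ℕ) : ℝ)) := by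
        push_cast
        rw [Real.log_mul p1.ne' p4.ne', Real.log_mul p3.ne' p2.ne']
        unfold LL; ring
      rw [h2, abs_mul, Nat.abs_cast]
      have h3 : √(((y.1 * y'.2 : ℕ) : ℝ) * ((y'.1 * y.2 : ℕ) : ℝ)) ≤ W := by
        apply Real.sqrt_le_iff.mpr
        refine ⟨hW0.le, ?_⟩
        have q1 := hYW y hy
        have q2 := hYW y' hy'
        push_cast
        calc (y.1 * y'.2 * (y'.1 * y.2) : ℝ) = (y.1 * y.2) * (y'.1 * y'.2) := by ring
          _ ≤ W * W := by gcongr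
          _ = W ^ 2 := by ring
      have h4 : δ ≤ 1 / (2 * √(((y.1 * y'.2 : ℕ) : ℝ) * ((y'.1 * y.2 : ℕ) : ℝ))) := by
        rw [hδ]
        apply one_div_le_one_div_of_le
        · have : (0:ℝ) < ((y.1 * y'.2 : ℕ) : ℝ) * ((y'.1 * y.2 : ℕ) : ℝ) := by
            push_cast; positivity
          positivity
        · gcongr
      have hb' : (1:ℝ) ≤ b := by exact_mod_cast hb
      have := abs_nonneg (Real.log ((y.1 * y'.2 : ℕ) : ℝ) - Real.log ((y'.1 * y.2 : ℕ) : ℝ))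
      nlinarith
    · intro y hy
      obtain ⟨⟨hy1, hy1K⟩, ⟨hy2, hy2K⟩⟩ := (mem_Fr.mp (hF y hy)).1
      have h1 := hXY y hy
      unfold MM
      rw [hM]
      apply min_le_min
      · gcongr
        calc _ ≤ (W ^ (a + b)) ^ (1 / (2 * ((a:ℝ) + b))) := by gcongr
          _ = √W := by
            rw [← Real.rpow_natCast, ← Real.rpow_mul hW0.le, Real.sqrt_eq_rpow]
            congr 1; push_cast
            have : (0:ℝ) < (a:ℝ) + b := by exact_mod_cast (by omega : 0 < a + b)
            field_simp
      · refine (inv_LL_le a b x y hx1 hx2 hy1 hy2).trans ?_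
        gcongr
    · intro y hy
      have h1 : MM a b V x y ≤ 1 / |LL a b x y| := min_le_right _ _
      rcases eq_or_lt_of_le (abs_nonneg (LL a b x y)) with h | h
      · rw [← h]; simp
      · rwa [le_div_iff₀ h] at h1
  have h1 : ∑ y ∈ F, (1 / ((y.1 : ℝ) * y.2)) * MM a b V x y ≤ ∑ y ∈ F, (2 / W) * MM a b V x y := by
    refine Finset.sum_le_sum fun y hy => ?_
    have := MM_nonneg a b V hV.le x y
    refine mul_le_mul_of_nonneg_right ?_ this
    have h2 : (2:ℝ) ^ j ≤ y.1 * y.2 := by exact_mod_cast hj1 y hy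
    rw [show 2 / W = 1 / 2 ^ j by rw [hW, pow_succ]; field_simp]
    exact one_div_le_one_div_of_le (by positivity) h2
  rw [← Finset.mul_sum] at h1
  refine h1.trans ?_
  have h2 := min_le_pow V W (a + b) hs hV hW0
  calc 2 / W * ∑ y ∈ F, MM a b V x y
      ≤ 2 / W * (2 * (M + 1 / δ * (1 + Real.log ((4 * (a + b) * K ^ 3 : ℕ))))) := by gcongr
    _ ≤ 2 / W * (2 * (2 * W * V ^ ((((a + b : ℕ):ℝ) - 2) / (((a + b : ℕ):ℝ) - 1)) +
          1 / δ * (1 + Real.log ((4 * (a + b) * K ^ 3 : ℕ))))) := by gcongr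
    _ = _ := by rw [hδ]; field_simp; ring


lemma inner_frac_sum (a b K : ℕ) (ha : 1 ≤ a) (hb : 1 ≤ b) (hs : 3 ≤ a + b) (V : ℝ) (hV : 0 < V)
    (x : ℕ × ℕ) (hx : x ∈ Fr K) :
    ∑ y ∈ (Fr K).filter (fun y => x.1 * x.2 ≤ y.1 * y.2), (1 / ((y.1 : ℝ) * y.2)) * MM a b V x y ≤
      ((Nat.log 2 (K ^ 2) + 1 : ℕ) : ℝ) *
      (8 * V ^ ((((a + b : ℕ):ℝ) - 2) / (((a + b : ℕ):ℝ) - 1)) +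
        8 * (1 + Real.log ((4 * (a + b) * K ^ 3 : ℕ)))) := by
  have hmaps : ∀ y ∈ (Fr K).filter (fun y => x.1 * x.2 ≤ y.1 * y.2),
      Nat.log 2 (y.1 * y.2) ∈ Finset.range (Nat.log 2 (K ^ 2) + 1) := by
    intro y hy
    obtain ⟨⟨hy1, hy1K⟩, ⟨hy2, hy2K⟩⟩ := (mem_Fr.mp (Finset.mem_filter.mp hy).1).1
    rw [Finset.mem_range, Nat.lt_succ_iff]
    apply Nat.log_mono_right
    rw [pow_two]; exact Nat.mul_le_mul hy1K hy2K
  rw [← Finset.sum_fiberwise_of_maps_to hmaps]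
  refine (Finset.sum_le_card_nsmul _ _
    (8 * V ^ ((((a + b : ℕ):ℝ) - 2) / (((a + b : ℕ):ℝ) - 1)) +
        8 * (1 + Real.log ((4 * (a + b) * K ^ 3 : ℕ)))) ?_).trans (le_of_eq ?_)
  · intro j hj
    apply class_sum a b K j ha hb hs V hV x hx
    · intro y hy; exact (Finset.mem_filter.mp (Finset.mem_filter.mp hy).1).1
    · intro y hy; exact (Finset.mem_filter.mp (Finset.mem_filter.mp hy).1).2
    · intro y hy
      have h1 := (mem_Fr.mp (Finset.mem_filter.mp (Finset.mem_filter.mp hy).1).1).1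
      have h2 := (Finset.mem_filter.mp hy).2
      rw [← h2]
      have := h1.1.1; have := h1.2.1
      exact Nat.pow_log_le_self 2 (by positivity)
    · intro y hy
      have h2 := (Finset.mem_filter.mp hy).2
      rw [← h2]
      exact Nat.lt_pow_succ_log_self (by norm_num) _
  · rw [Finset.card_range, nsmul_eq_mul]

lemma sum_inv_Sq (K : ℕ) : ∑ x ∈ Sq K, 1 / ((x.1 : ℝ) * x.2) ≤ (1 + Real.log K) ^ 2 := by
  have h : ∑ x ∈ Sq K, 1 / ((x.1 : ℝ) * x.2) = (∑ k ∈ Finset.Icc 1 K, 1 / (k:ℝ)) ^ 2 := by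
    rw [pow_two, Finset.sum_mul_sum, Sq, Finset.sum_product]
    refine Finset.sum_congr rfl fun i _ => Finset.sum_congr rfl fun j _ => ?_
    rw [one_div_mul_one_div]
  rw [h]
  have := harm_le K
  gcongr

lemma sum_inv_Fr (K : ℕ) : ∑ x ∈ Fr K, 1 / ((x.1 : ℝ) * x.2) ≤ (1 + Real.log K) ^ 2 := by
  refine le_trans ?_ (sum_inv_Sq K)
  exact Finset.sum_le_sum_of_subset_of_nonneg (Finset.filter_subset _ _)
    fun _ _ _ => by positivity

lemma half_sum (a b K : ℕ) (ha : 1 ≤ a) (hb : 1 ≤ b) (hs : 3 ≤ a + b) (hK : 1 ≤ K) (V : ℝ)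
    (hV : 0 < V) :
    ∑ x ∈ Fr K, ∑ y ∈ (Fr K).filter (fun y => x.1 * x.2 ≤ y.1 * y.2), EE a b V x y ≤
      32 * (3 + Real.log ((4 * (a + b) : ℕ))) * (1 + Real.log K) ^ 3 *
      (V ^ ((((a + b : ℕ):ℝ) - 2) / (((a + b : ℕ):ℝ) - 1)) + (1 + Real.log K)) := by
  set θ := V ^ ((((a + b : ℕ):ℝ) - 2) / (((a + b : ℕ):ℝ) - 1)) with hθ
  have hθ0 : 0 ≤ θ := by positivity
  set c := Real.log ((4 * (a + b) : ℕ)) with hc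
  have hc0 : 0 ≤ c := Real.log_natCast_nonneg _
  set l := Real.log K with hl
  have hl0 : 0 ≤ l := Real.log_natCast_nonneg _
  set J : ℝ := ((Nat.log 2 (K ^ 2) + 1 : ℕ) : ℝ) with hJ
  set B : ℝ := 8 * θ + 8 * (1 + Real.log ((4 * (a + b) * K ^ 3 : ℕ))) with hB
  have hKr : (0:ℝ) < K := by exact_mod_cast hK
  have e1 : Real.log ((4 * (a + b) * K ^ 3 : ℕ)) = c + 3 * l := by
    rw [Nat.cast_mul, Real.log_mul, Nat.cast_pow, Real.log_pow]
    · rw [hc, hl]; push_cast; ring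
    · have : 0 < 4 * (a + b) := by omega
      exact_mod_cast this.ne'
    · positivity
  have hB1 : B ≤ 8 * (3 + c) * (θ + (1 + l)) := by
    rw [hB, e1]; nlinarith [mul_nonneg hc0 hl0, mul_nonneg hc0 hθ0]
  have hB0 : 0 ≤ B := by rw [hB, e1]; positivity
  have hJ1 : J ≤ 4 * (1 + l) := by
    have h1 := Real.natLog_le_logb (K^2) 2
    have h2 : Real.logb 2 ((K^2 : ℕ):ℝ) = 2 * l / Real.log 2 := by
      rw [Real.logb]; push_cast; rw [Real.log_pow, hl]; norm_num
    have h3 : 2 * l / Real.log 2 ≤ 3 * l := by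
      have := Real.log_two_gt_d9
      rw [div_le_iff₀ (by linarith)]; nlinarith
    rw [hJ]; push_cast; push_cast at h1 h2; linarith
  have h1 : ∀ x ∈ Fr K, ∑ y ∈ (Fr K).filter (fun y => x.1 * x.2 ≤ y.1 * y.2), EE a b V x y ≤
      1 / ((x.1 : ℝ) * x.2) * (J * B) := by
    intro x hx
    have := inner_frac_sum a b K ha hb hs V hV x hx
    calc _ = 1 / ((x.1 : ℝ) * x.2) * ∑ y ∈ (Fr K).filter (fun y => x.1 * x.2 ≤ y.1 * y.2), (1 / ((y.1 : ℝ) * y.2)) * MM a b V x y := by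
          rw [Finset.mul_sum]
          refine Finset.sum_congr rfl fun y _ => ?_
          unfold EE; ring
      _ ≤ _ := by gcongr
  refine (Finset.sum_le_sum h1).trans ?_
  rw [← Finset.sum_mul]
  have h2 := sum_inv_Fr K
  have hJ0 : 0 ≤ J := by positivity
  calc _ ≤ (1 + l) ^ 2 * ((4 * (1 + l)) * (8 * (3 + c) * (θ + (1 + l)))) := by gcongr
    _ = _ := by ring

lemma EE_symm (a b : ℕ) (V : ℝ) (x y : ℕ × ℕ) : EE a b V x y = EE b a V y x := by
  unfold EE MM
  rw [show LL a b x y = LL b a y x by unfold LL; ring, add_comm (a:ℝ) b,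
    mul_comm (((x.1 : ℝ) * x.2) ^ a)]
  ring

lemma full_sum (a b K : ℕ) (ha : 1 ≤ a) (hb : 1 ≤ b) (hs : 3 ≤ a + b) (hK : 1 ≤ K) (V : ℝ)
    (hV : 0 < V) :
    ∑ x ∈ Fr K, ∑ y ∈ Fr K, EE a b V x y ≤
      64 * (3 + Real.log ((4 * (a + b) : ℕ))) * (1 + Real.log K) ^ 3 *
      (V ^ ((((a + b : ℕ):ℝ) - 2) / (((a + b : ℕ):ℝ) - 1)) + (1 + Real.log K)) := by
  have h1 := half_sum a b K ha hb hs hK V hV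
  have h2 := half_sum b a K hb ha (by omega) hK V hV
  rw [Nat.add_comm b a] at h2
  have h3 : ∑ x ∈ Fr K, ∑ y ∈ Fr K, EE a b V x y ≤
    ∑ x ∈ Fr K, ∑ y ∈ (Fr K).filter (fun y => x.1 * x.2 ≤ y.1 * y.2), EE a b V x y +
    ∑ x ∈ Fr K, ∑ y ∈ (Fr K).filter (fun y => x.1 * x.2 ≤ y.1 * y.2), EE b a V x y := by
    have e : ∑ x ∈ Fr K, ∑ y ∈ (Fr K).filter (fun y => x.1 * x.2 ≤ y.1 * y.2), EE b a V x y
      = ∑ x ∈ Fr K, ∑ y ∈ (Fr K).filter (fun y => y.1 * y.2 ≤ x.1 * x.2), EE a b V x y := by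
      simp only [Finset.sum_filter]
      rw [Finset.sum_comm]
      simp only [EE_symm b a]
    rw [e, ← Finset.sum_add_distrib]
    refine Finset.sum_le_sum fun x _ => ?_
    simp only [Finset.sum_filter]
    rw [← Finset.sum_add_distrib]
    refine Finset.sum_le_sum fun y _ => ?_
    have := EE_nonneg a b V hV.le x y
    rcases le_total (x.1 * x.2) (y.1 * y.2) with h | h
    · rw [if_pos h]; split_ifs <;> linarith
    · rw [if_pos h]; split_ifs <;> linarith
  linarith

lemma EE_scale (a b g k : ℕ) (ha : 1 ≤ a) (hb : 1 ≤ b) (hg : 1 ≤ g) (hk : 1 ≤ k) (V : ℝ)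
    (hV : 0 < V) (x y : ℕ × ℕ) (hx1 : 1 ≤ x.1) (hx2 : 1 ≤ x.2) (hy1 : 1 ≤ y.1) (hy2 : 1 ≤ y.2) :
    EE a b V (g * x.1, g * x.2) (k * y.1, k * y.2) ≤
      (g:ℝ) ^ (-2 + (a:ℝ) / (a + b)) * (k:ℝ) ^ (-2 + (b:ℝ) / (a + b)) * EE a b V x y := by
  have p1 : (0:ℝ) < x.1 := by exact_mod_cast hx1
  have p2 : (0:ℝ) < x.2 := by exact_mod_cast hx2
  have p3 : (0:ℝ) < y.1 := by exact_mod_cast hy1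
  have p4 : (0:ℝ) < y.2 := by exact_mod_cast hy2
  have p5 : (1:ℝ) ≤ g := by exact_mod_cast hg
  have p6 : (1:ℝ) ≤ k := by exact_mod_cast hk
  have g0 : (0:ℝ) < g := by linarith
  have k0 : (0:ℝ) < k := by linarith
  have s0 : (0:ℝ) < (a:ℝ) + b := by exact_mod_cast (by omega : 0 < a + b)
  have hL : LL a b (g * x.1, g * x.2) (k * y.1, k * y.2) = LL a b x y := by
    unfold LL; push_cast
    rw [Real.log_mul, Real.log_mul, Real.log_mul, Real.log_mul] <;> first | positivity | ring
  set q : ℝ := (g:ℝ) ^ ((a:ℝ) / (a + b)) * (k:ℝ) ^ ((b:ℝ) / (a + b)) with hq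
  have hq1 : 1 ≤ q := by
    rw [hq]
    exact one_le_mul_of_one_le_of_one_le (Real.one_le_rpow p5 (by positivity))
      (Real.one_le_rpow p6 (by positivity))
  have hP : ((((g * x.1 : ℕ) : ℝ) * ((g * x.2 : ℕ):ℝ)) ^ a * (((k * y.1 : ℕ) : ℝ) * ((k * y.2 : ℕ):ℝ)) ^ b) ^ (1 / (2 * ((a : ℝ) + b)))
      = q * (((x.1 : ℝ) * x.2) ^ a * ((y.1 : ℝ) * y.2) ^ b) ^ (1 / (2 * ((a : ℝ) + b))) := by
    push_cast
    rw [show ((g * x.1 * (g * x.2) : ℝ)) ^ a * (k * y.1 * (k * y.2)) ^ b =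
      (((g:ℝ) ^ (2 * a)) * (k:ℝ) ^ (2 * b)) * (((x.1 : ℝ) * x.2) ^ a * ((y.1 : ℝ) * y.2) ^ b) by
        rw [pow_mul, pow_mul]; simp only [mul_pow]; ring]
    rw [Real.mul_rpow (by positivity) (by positivity), Real.mul_rpow (by positivity) (by positivity),
      ← Real.rpow_natCast, ← Real.rpow_natCast, ← Real.rpow_mul g0.le, ← Real.rpow_mul k0.le, hq]
    congr 3
    · push_cast; field_simp
    · push_cast; field_simp
  have hM : MM a b V (g * x.1, g * x.2) (k * y.1, k * y.2) ≤ q * MM a b V x y := by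
    unfold MM
    simp only [hL, hP]
    rw [mul_min_of_nonneg _ _ (by linarith)]
    apply min_le_min
    · exact le_of_eq (by ring)
    · exact le_mul_of_one_le_left (by positivity) hq1
  unfold EE
  have hM0 := MM_nonneg a b V hV.le x y
  have e1 : (g:ℝ) ^ (-2 + (a:ℝ) / (a + b)) = 1 / g ^ 2 * (g:ℝ) ^ ((a:ℝ) / (a + b)) := by
    rw [Real.rpow_add g0, Real.rpow_neg g0.le, one_div]; norm_cast
  have e2 : (k:ℝ) ^ (-2 + (b:ℝ) / (a + b)) = 1 / k ^ 2 * (k:ℝ) ^ ((b:ℝ) / (a + b)) := by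
    rw [Real.rpow_add k0, Real.rpow_neg k0.le, one_div]; norm_cast
  rw [e1, e2]
  push_cast
  calc _ ≤ 1 / ((g:ℝ) * x.1 * (g * x.2)) * (1 / ((k:ℝ) * y.1 * (k * y.2))) * (q * MM a b V x y) := by
        gcongr
    _ = _ := by rw [hq]; field_simp

lemma reduce_sum (K : ℕ) (Φ : ℕ × ℕ → ℝ) (hΦ : ∀ x, 0 ≤ Φ x) :
    ∑ h ∈ Sq K, Φ h ≤ ∑ g ∈ Finset.Icc 1 K, ∑ x ∈ Fr K, Φ (g * x.1, g * x.2) := by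
  classical
  rw [← Finset.sum_product']
  set e : ℕ × ℕ → ℕ × (ℕ × ℕ) := fun h => (Nat.gcd h.1 h.2, (h.1 / Nat.gcd h.1 h.2, h.2 / Nat.gcd h.1 h.2))
  have hinv : ∀ h : ℕ × ℕ, ((e h).1 * (e h).2.1, (e h).1 * (e h).2.2) = h := by
    intro h
    simp only [e, Nat.mul_div_cancel' (Nat.gcd_dvd_left _ _), Nat.mul_div_cancel' (Nat.gcd_dvd_right _ _)]
  have hinj : Set.InjOn e (Sq K) := by
    intro h _ h' _ hh
    rw [← hinv h, ← hinv h', hh]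
  have h1 : ∑ h ∈ Sq K, Φ h = ∑ z ∈ (Sq K).image e, Φ (z.1 * z.2.1, z.1 * z.2.2) := by
    rw [Finset.sum_image hinj]
    exact Finset.sum_congr rfl fun h _ => by rw [hinv h]
  rw [h1]
  apply Finset.sum_le_sum_of_subset_of_nonneg
  · intro z hz
    obtain ⟨h, hh, rfl⟩ := Finset.mem_image.mp hz
    obtain ⟨⟨h1, h1K⟩, ⟨h2, h2K⟩⟩ := mem_Sq.mp hh
    have gp : 0 < Nat.gcd h.1 h.2 := Nat.gcd_pos_of_pos_left _ h1
    simp only [Finset.mem_product, Finset.mem_Icc, mem_Fr, e]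
    refine ⟨⟨gp, (Nat.gcd_le_left _ h1).trans h1K⟩, ⟨⟨?_, ?_⟩, ⟨?_, ?_⟩⟩, ?_⟩
    · exact Nat.div_pos (Nat.gcd_le_left _ h1) gp
    · exact (Nat.div_le_self _ _).trans h1K
    · exact Nat.div_pos (Nat.gcd_le_right _ h2) gp
    · exact (Nat.div_le_self _ _).trans h2K
    · exact Nat.coprime_div_gcd_div_gcd gp
  · intro z _ _; exact hΦ _

lemma zeta_bd (c : ℝ) (hc : c < -1) : ∃ Z : ℝ, 0 ≤ Z ∧ ∀ K : ℕ, ∑ g ∈ Finset.Icc 1 K, (g:ℝ) ^ c ≤ Z := by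
  have hs := Real.summable_nat_rpow.mpr hc
  exact ⟨∑' n : ℕ, (n:ℝ) ^ c, tsum_nonneg fun n => by positivity,
    fun K => hs.sum_le_tsum _ fun n _ => by positivity⟩

lemma off_sum (a b : ℕ) (ha : 1 ≤ a) (hb : 1 ≤ b) (hs : 3 ≤ a + b) :
    ∃ C : ℝ, 0 ≤ C ∧ ∀ (K : ℕ) (V : ℝ), 1 ≤ K → 0 < V →
    ∑ h ∈ Sq K, ∑ r ∈ Sq K, EE a b V h r ≤ C * (1 + Real.log K) ^ 3 *
      (V ^ ((((a + b : ℕ):ℝ) - 2) / (((a + b : ℕ):ℝ) - 1)) + (1 + Real.log K)) := by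
  have a0 : (0:ℝ) < a := by exact_mod_cast ha
  have b0 : (0:ℝ) < b := by exact_mod_cast hb
  obtain ⟨Z1, hZ1, hZ1'⟩ := zeta_bd (-2 + (a:ℝ) / (a + b)) (by
    have : (a:ℝ) / (a + b) < 1 := by rw [div_lt_one (by positivity)]; linarith
    linarith)
  obtain ⟨Z2, hZ2, hZ2'⟩ := zeta_bd (-2 + (b:ℝ) / (a + b)) (by
    have : (b:ℝ) / (a + b) < 1 := by rw [div_lt_one (by positivity)]; linarith
    linarith)
  have hc0 : 0 ≤ Real.log ((4 * (a + b) : ℕ)) := Real.log_natCast_nonneg _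
  refine ⟨Z1 * Z2 * (64 * (3 + Real.log ((4 * (a + b) : ℕ)))), by positivity, ?_⟩
  intro K V hK hV
  have hl0 : 0 ≤ Real.log K := Real.log_natCast_nonneg _
  have hfull := full_sum a b K ha hb hs hK V hV
  have h1 : ∑ h ∈ Sq K, ∑ r ∈ Sq K, EE a b V h r ≤
      ∑ g ∈ Finset.Icc 1 K, ∑ x ∈ Fr K, ∑ k ∈ Finset.Icc 1 K, ∑ y ∈ Fr K,
        EE a b V (g * x.1, g * x.2) (k * y.1, k * y.2) := by
    refine (reduce_sum K (fun h => ∑ r ∈ Sq K, EE a b V h r)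
      (fun x => Finset.sum_nonneg fun r _ => EE_nonneg a b V hV.le _ _)).trans ?_
    refine Finset.sum_le_sum fun g _ => Finset.sum_le_sum fun x _ => ?_
    exact reduce_sum K (fun r => EE a b V (g * x.1, g * x.2) r) (fun r => EE_nonneg a b V hV.le _ _)
  have h2 : ∑ g ∈ Finset.Icc 1 K, ∑ x ∈ Fr K, ∑ k ∈ Finset.Icc 1 K, ∑ y ∈ Fr K,
        EE a b V (g * x.1, g * x.2) (k * y.1, k * y.2) ≤
      ∑ g ∈ Finset.Icc 1 K, ∑ x ∈ Fr K, ∑ k ∈ Finset.Icc 1 K, ∑ y ∈ Fr K,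
        (g:ℝ) ^ (-2 + (a:ℝ) / (a + b)) * ((k:ℝ) ^ (-2 + (b:ℝ) / (a + b)) * EE a b V x y) := by
    refine Finset.sum_le_sum fun g hg => Finset.sum_le_sum fun x hx =>
      Finset.sum_le_sum fun k hk => Finset.sum_le_sum fun y hy => ?_
    have hx' := mem_Fr.mp hx
    have hy' := mem_Fr.mp hy
    rw [← mul_assoc]
    exact EE_scale a b g k ha hb (Finset.mem_Icc.mp hg).1 (Finset.mem_Icc.mp hk).1 V hV x y
      hx'.1.1.1 hx'.1.2.1 hy'.1.1.1 hy'.1.2.1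
  have h3 : ∑ g ∈ Finset.Icc 1 K, ∑ x ∈ Fr K, ∑ k ∈ Finset.Icc 1 K, ∑ y ∈ Fr K,
        (g:ℝ) ^ (-2 + (a:ℝ) / (a + b)) * ((k:ℝ) ^ (-2 + (b:ℝ) / (a + b)) * EE a b V x y)
      = (∑ g ∈ Finset.Icc 1 K, (g:ℝ) ^ (-2 + (a:ℝ) / (a + b))) *
        ((∑ k ∈ Finset.Icc 1 K, (k:ℝ) ^ (-2 + (b:ℝ) / (a + b))) *
          ∑ x ∈ Fr K, ∑ y ∈ Fr K, EE a b V x y) := by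
    simp only [← Finset.mul_sum, ← Finset.sum_mul]
  refine h1.trans (h2.trans ?_)
  rw [h3]
  have hE : 0 ≤ ∑ x ∈ Fr K, ∑ y ∈ Fr K, EE a b V x y :=
    Finset.sum_nonneg fun x _ => Finset.sum_nonneg fun y _ => EE_nonneg a b V hV.le _ _
  calc _ ≤ Z1 * (Z2 * (64 * (3 + Real.log ((4 * (a + b) : ℕ))) * (1 + Real.log K) ^ 3 *
      (V ^ ((((a + b : ℕ):ℝ) - 2) / (((a + b : ℕ):ℝ) - 1)) + (1 + Real.log K)))) := by
        have q1 := hZ1' K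
        have q2 := hZ2' K
        have q3 : 0 ≤ ∑ k ∈ Finset.Icc 1 K, (k:ℝ) ^ (-2 + (b:ℝ) / (a + b)) :=
          Finset.sum_nonneg fun k _ => by positivity
        gcongr
    _ = _ := by ring


lemma diag_real (a b g k p q m n : ℝ) (ha : 0 < a) (hab : a ≤ b) (hg : 1 ≤ g) (hk : 1 ≤ k)
    (hm : 1 ≤ m) (hn : 1 ≤ n) (hp : n ≤ p) (hq : m ≤ q) :
    ((g * p) * (g * q)) ^ (-(a + 2 * b) / (2 * (a + b))) *
      ((k * m) * (k * n)) ^ (-(2 * a + b) / (2 * (a + b))) * (g * k * p * q) ^ (a / (2 * (a + b)))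
    ≤ g ^ (-1 - a / (2 * (a + b))) * k ^ (-1 - a / (2 * (a + b))) * m ^ (-1 - a / (2 * (a + b))) *
      n ^ (-1 - a / (2 * (a + b))) := by
  have g0 : 0 < g := by linarith
  have k0 : 0 < k := by linarith
  have m0 : 0 < m := by linarith
  have n0 : 0 < n := by linarith
  have p0 : 0 < p := by linarith
  have q0 : 0 < q := by linarith
  have G := Real.log_nonneg hg
  have Kk := Real.log_nonneg hk
  have M := Real.log_nonneg hm
  have N := Real.log_nonneg hn
  have PN := Real.log_le_log n0 hp
  have QM := Real.log_le_log m0 hq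
  rw [← Real.log_le_log_iff (by positivity) (by positivity)]
  have s0 : 0 < 2 * (a + b) := by linarith
  rw [Real.log_mul (by positivity) (by positivity), Real.log_mul (by positivity) (by positivity),
    Real.log_mul (by positivity) (by positivity), Real.log_mul (by positivity) (by positivity),
    Real.log_mul (by positivity) (by positivity)]
  simp only [Real.log_rpow (show 0 < g * p * (g * q) by positivity),
    Real.log_rpow (show 0 < k * m * (k * n) by positivity),
    Real.log_rpow (show 0 < g * k * p * q by positivity), Real.log_rpow g0, Real.log_rpow k0,
    Real.log_rpow m0, Real.log_rpow n0]
  rw [Real.log_mul (x := g * p) (by positivity) (by positivity), Real.log_mul (x := k * m) (by positivity) (by positivity),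
    Real.log_mul (x := g * k * p) (by positivity) (by positivity),
    Real.log_mul (x := g * k) (by positivity) (by positivity),
    Real.log_mul (x := g) (y := p) (by positivity) (by positivity),
    Real.log_mul (x := g) (y := q) (by positivity) (by positivity),
    Real.log_mul (x := g) (y := k) (by positivity) (by positivity),
    Real.log_mul (x := k) (y := m) (by positivity) (by positivity),
    Real.log_mul (x := k) (y := n) (by positivity) (by positivity)]
  rw [← sub_nonneg]
  have sne : a + b ≠ 0 := by linarith
  have e : ((-1 - a / (2 * (a + b))) * Real.log g + (-1 - a / (2 * (a + b))) * Real.log k + (-1 - a / (2 * (a + b))) * Real.log m +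
      (-1 - a / (2 * (a + b))) * Real.log n -
      (-(a + 2 * b) / (2 * (a + b)) * (Real.log g + Real.log p + (Real.log g + Real.log q)) + -(2 * a + b) / (2 * (a + b)) * (Real.log k + Real.log m + (Real.log k + Real.log n)) +
      a / (2 * (a + b)) * (Real.log g + Real.log k + Real.log p + Real.log q))) =
      (2 * (b - a) * Real.log g + 2 * b * (Real.log p - Real.log n) + 2 * b * (Real.log q - Real.log m)
       + (b - a) * Real.log m + (b - a) * Real.log n) / (2 * (a + b)) := by
    field_simp; ring
  rw [e]
  have h1 : 0 ≤ b - a := by linarith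
  have h2 : 0 ≤ b := by linarith
  have h3 := sub_nonneg.mpr PN
  have h4 := sub_nonneg.mpr QM
  positivity

lemma diag_nat (a b h1 h2 r1 r2 : ℕ) (ha : 1 ≤ a) (hab : a < b) (H1 : 1 ≤ h1) (H2 : 1 ≤ h2)
    (R1 : 1 ≤ r1) (R2 : 1 ≤ r2) (he : h1 ^ a * r1 ^ b = h2 ^ a * r2 ^ b) :
    ((h1:ℝ) * h2) ^ (-((a:ℝ) + 2 * b) / (2 * (a + b))) *
      ((r1:ℝ) * r2) ^ (-(2 * (a:ℝ) + b) / (2 * (a + b))) *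
      ((h1:ℝ) ^ ((a:ℝ) / (2 * (a + b))) + (h2:ℝ) ^ ((a:ℝ) / (2 * (a + b))) +
        (r1:ℝ) ^ ((a:ℝ) / (2 * (a + b))) + (r2:ℝ) ^ ((a:ℝ) / (2 * (a + b)))) ≤
    4 * (((Nat.gcd h1 h2 : ℕ) : ℝ) ^ (-1 - (a:ℝ) / (2 * (a + b))) *
     ((Nat.gcd r1 r2 : ℕ) : ℝ) ^ (-1 - (a:ℝ) / (2 * (a + b))) *
     ((r1 / Nat.gcd r1 r2 : ℕ) : ℝ) ^ (-1 - (a:ℝ) / (2 * (a + b))) *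
     ((r2 / Nat.gcd r1 r2 : ℕ) : ℝ) ^ (-1 - (a:ℝ) / (2 * (a + b)))) := by
  obtain ⟨p, q, hpq, hp, hq⟩ := Nat.exists_coprime h1 h2
  obtain ⟨m, n, hmn, hm, hn⟩ := Nat.exists_coprime r1 r2
  have gp : 0 < Nat.gcd h1 h2 := Nat.gcd_pos_of_pos_left _ H1
  have kp : 0 < Nat.gcd r1 r2 := Nat.gcd_pos_of_pos_left _ R1
  generalize Nat.gcd h1 h2 = g at *
  generalize Nat.gcd r1 r2 = k at *
  have hm' : r1 / k = m := by rw [hm]; exact Nat.mul_div_cancel _ kp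
  have hn' : r2 / k = n := by rw [hn]; exact Nat.mul_div_cancel _ kp
  rw [hm', hn']
  have m1 : 1 ≤ m := by
    rcases Nat.eq_zero_or_pos m with h | h
    · rw [h] at hm; omega
    · exact h
  have n1 : 1 ≤ n := by
    rcases Nat.eq_zero_or_pos n with h | h
    · rw [h] at hn; omega
    · exact h
  have he2 : p ^ a * m ^ b = q ^ a * n ^ b := by
    rw [hp, hq, hm, hn] at he
    have : (g ^ a * k ^ b) * (p ^ a * m ^ b) = (g ^ a * k ^ b) * (q ^ a * n ^ b) := by
      simp only [mul_pow] at he; linarith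
    exact Nat.eq_of_mul_eq_mul_left (by positivity) this
  have d1 : n ^ b ∣ p ^ a := by
    have : n ^ b ∣ p ^ a * m ^ b := he2 ▸ Dvd.intro_left _ rfl
    exact (Nat.Coprime.pow _ _ hmn.symm).dvd_of_dvd_mul_right this
  have d2 : m ^ b ∣ q ^ a := by
    have : m ^ b ∣ q ^ a * n ^ b := he2 ▸ Dvd.intro_left _ rfl
    exact (Nat.Coprime.pow _ _ hmn).dvd_of_dvd_mul_right this
  have p1 : 1 ≤ p := by
    rcases Nat.eq_zero_or_pos p with h | h
    · rw [h] at hp; omega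
    · exact h
  have q1 : 1 ≤ q := by
    rcases Nat.eq_zero_or_pos q with h | h
    · rw [h] at hq; omega
    · exact h
  have np : n ≤ p := by
    have h1 : n ^ b ≤ p ^ a := Nat.le_of_dvd (by positivity) d1
    have h2 : n ^ a ≤ n ^ b := Nat.pow_le_pow_right n1 hab.le
    exact (Nat.pow_le_pow_iff_left (by omega)).mp (h2.trans h1)
  have mq : m ≤ q := by
    have h1 : m ^ b ≤ q ^ a := Nat.le_of_dvd (by positivity) d2
    have h2 : m ^ a ≤ m ^ b := Nat.pow_le_pow_right m1 hab.le
    exact (Nat.pow_le_pow_iff_left (by omega)).mp (h2.trans h1)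
  have G : (1:ℝ) ≤ g := by exact_mod_cast gp
  have K : (1:ℝ) ≤ k := by exact_mod_cast kp
  have M : (1:ℝ) ≤ m := by exact_mod_cast m1
  have N : (1:ℝ) ≤ n := by exact_mod_cast n1
  have NP : (n:ℝ) ≤ p := by exact_mod_cast np
  have MQ : (m:ℝ) ≤ q := by exact_mod_cast mq
  have P : (1:ℝ) ≤ p := by linarith
  have Q : (1:ℝ) ≤ q := by linarith
  have A0 : (0:ℝ) < a := by exact_mod_cast ha
  have AB : (a:ℝ) ≤ b := by exact_mod_cast hab.le
  have key := diag_real a b g k p q m n A0 AB G K M N NP MQ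
  have e1 : (h1:ℝ) = g * p := by rw [mul_comm]; exact_mod_cast hp
  have e2 : (h2:ℝ) = g * q := by rw [mul_comm]; exact_mod_cast hq
  have e3 : (r1:ℝ) = k * m := by rw [mul_comm]; exact_mod_cast hm
  have e4 : (r2:ℝ) = k * n := by rw [mul_comm]; exact_mod_cast hn
  rw [e1, e2, e3, e4]
  have gk : (1:ℝ) ≤ g * k := one_le_mul_of_one_le_of_one_le G K
  have pq : (1:ℝ) ≤ p * q := one_le_mul_of_one_le_of_one_le P Q
  have kq : (1:ℝ) ≤ k * q := one_le_mul_of_one_le_of_one_le K Q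
  have kp' : (1:ℝ) ≤ k * p := one_le_mul_of_one_le_of_one_le K P
  have gp' : (1:ℝ) ≤ g * p := one_le_mul_of_one_le_of_one_le G P
  have gq' : (1:ℝ) ≤ g * q := one_le_mul_of_one_le_of_one_le G Q
  have mono : ∀ z : ℝ, 0 ≤ z → z ≤ g * k * p * q →
      z ^ ((a:ℝ) / (2 * (a + b))) ≤ (g * k * p * q : ℝ) ^ ((a:ℝ) / (2 * (a + b))) := by
    intro z hz h
    exact Real.rpow_le_rpow hz h (by positivity)
  have i1 := mono (g * p) (by positivity) (by rw [show (g * k * p * q : ℝ) = (g * p) * (k * q) by ring]; exact le_mul_of_one_le_right (by positivity) kq)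
  have i2 := mono (g * q) (by positivity) (by rw [show (g * k * p * q : ℝ) = (g * q) * (k * p) by ring]; exact le_mul_of_one_le_right (by positivity) kp')
  have i3 := mono (k * m) (by positivity) (by rw [show (g * k * p * q : ℝ) = (k * q) * (g * p) by ring]; exact le_trans (by gcongr) (le_mul_of_one_le_right (by positivity) gp'))
  have i4 := mono (k * n) (by positivity) (by rw [show (g * k * p * q : ℝ) = (k * p) * (g * q) by ring]; exact le_trans (by gcongr) (le_mul_of_one_le_right (by positivity) gq'))
  refine le_trans (mul_le_mul_of_nonneg_left (show _ ≤ 4 * (g * k * p * q : ℝ) ^ ((a:ℝ) / (2 * (a + b))) by linarith) (by positivity)) ?_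
  linarith

/-- summand of `Gab`, on natural numbers -/
noncomputable def gterm (a b h1 h2 r1 r2 : ℕ) : ℝ :=
  if h1 ^ a * r1 ^ b = h2 ^ a * r2 ^ b then
    ((h1:ℝ) * h2) ^ (-((a:ℝ) + 2 * b) / (2 * (a + b))) *
      ((r1:ℝ) * r2) ^ (-(2 * (a:ℝ) + b) / (2 * (a + b))) else 0

lemma gterm_nonneg (a b h1 h2 r1 r2 : ℕ) : 0 ≤ gterm a b h1 h2 r1 r2 := by
  unfold gterm; split_ifs <;> positivity

noncomputable def gmu (a b h1 h2 r1 r2 : ℕ) : ℝ :=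
  ((h1:ℝ) ^ ((a:ℝ) / (2 * (a + b))) + (h2:ℝ) ^ ((a:ℝ) / (2 * (a + b))) +
        (r1:ℝ) ^ ((a:ℝ) / (2 * (a + b))) + (r2:ℝ) ^ ((a:ℝ) / (2 * (a + b))))

lemma Gab_eq (a b : ℕ) : Gab a b = ∑' q : ℕ+ × ℕ+ × ℕ+ × ℕ+,
    gterm a b q.1 q.2.1 q.2.2.1 q.2.2.2 := by
  classical
  unfold Gab gterm
  refine tsum_congr fun q => ?_
  have : ((q.1 : ℝ) ^ (a:ℝ) * (q.2.2.1 : ℝ) ^ (b:ℝ) = (q.2.1 : ℝ) ^ (a:ℝ) * (q.2.2.2 : ℝ) ^ (b:ℝ)) ↔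
    ((q.1 : ℕ) ^ a * (q.2.2.1 : ℕ) ^ b = (q.2.1 : ℕ) ^ a * (q.2.2.2 : ℕ) ^ b) := by
    rw [Real.rpow_natCast, Real.rpow_natCast, Real.rpow_natCast, Real.rpow_natCast]
    norm_cast
  by_cases h : ((q.1 : ℕ) ^ a * (q.2.2.1 : ℕ) ^ b = (q.2.1 : ℕ) ^ a * (q.2.2.2 : ℕ) ^ b)
  · rw [if_pos h, if_pos (this.mpr h)]
  · rw [if_neg h, if_neg (fun h' => h (this.mp h'))]

lemma gsummable (a b : ℕ) (ha : 1 ≤ a) (hab : a < b) :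
    Summable (fun q : ℕ+ × ℕ+ × ℕ+ × ℕ+ => gterm a b q.1 q.2.1 q.2.2.1 q.2.2.2 *
      gmu a b q.1 q.2.1 q.2.2.1 q.2.2.2) := by
  classical
  set η : ℝ := -1 - (a:ℝ) / (2 * (a + b)) with hη
  have A0 : (0:ℝ) < a := by exact_mod_cast ha
  have B0 : (0:ℝ) < b := by exact_mod_cast (by omega : 0 < b)
  have hη1 : η < -1 := by
    have : 0 < (a:ℝ) / (2 * (a + b)) := by positivity
    rw [hη]; linarith
  have hs := Real.summable_nat_rpow.mpr hη1
  have h0 : ∀ n : ℕ, 0 ≤ (n:ℝ) ^ η := fun n => by positivity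
  have hs4 : Summable (fun z : ((ℕ × ℕ) × ℕ) × ℕ => (z.1.1.1:ℝ) ^ η * (z.1.1.2:ℝ) ^ η * (z.1.2:ℝ) ^ η * (z.2:ℝ) ^ η) := by
    have s2 := hs.mul_of_nonneg hs h0 h0
    have s3 := s2.mul_of_nonneg hs (fun z => mul_nonneg (h0 _) (h0 _)) h0
    exact s3.mul_of_nonneg hs (fun z => mul_nonneg (mul_nonneg (h0 _) (h0 _)) (h0 _)) h0
  set B : ((ℕ × ℕ) × ℕ) × ℕ → ℝ := fun z => (z.1.1.1:ℝ) ^ η * (z.1.1.2:ℝ) ^ η * (z.1.2:ℝ) ^ η * (z.2:ℝ) ^ η with hB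
  have hB0 : ∀ z, 0 ≤ B z := fun z => by simp only [hB]; positivity
  set e : ℕ+ × ℕ+ × ℕ+ × ℕ+ → ((ℕ × ℕ) × ℕ) × ℕ := fun q =>
    (((Nat.gcd q.1 q.2.1, Nat.gcd q.2.2.1 q.2.2.2), (q.2.2.1 : ℕ) / Nat.gcd q.2.2.1 q.2.2.2),
      (q.2.2.2 : ℕ) / Nat.gcd q.2.2.1 q.2.2.2) with he
  set cond : ℕ+ × ℕ+ × ℕ+ × ℕ+ → Prop := fun q =>
    (q.1 : ℕ) ^ a * (q.2.2.1 : ℕ) ^ b = (q.2.1 : ℕ) ^ a * (q.2.2.2 : ℕ) ^ b with hcond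
  apply summable_of_sum_le (c := 4 * ∑' z, B z)
  · intro q
    apply mul_nonneg (gterm_nonneg _ _ _ _ _ _)
    unfold gmu; positivity
  intro u
  have h1 : ∑ q ∈ u, gterm a b q.1 q.2.1 q.2.2.1 q.2.2.2 * gmu a b q.1 q.2.1 q.2.2.1 q.2.2.2
      ≤ ∑ q ∈ u.filter cond, 4 * B (e q) := by
    rw [Finset.sum_filter]
    refine Finset.sum_le_sum fun q _ => ?_
    by_cases h : cond q
    · rw [if_pos h]
      unfold gterm gmu
      rw [if_pos h]
      exact diag_nat a b q.1 q.2.1 q.2.2.1 q.2.2.2 ha hab q.1.pos q.2.1.pos q.2.2.1.pos q.2.2.2.pos h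
    · rw [if_neg h]
      unfold gterm
      rw [if_neg h, zero_mul]
  have hinj : Set.InjOn e (u.filter cond) := by
    intro q hq q' hq' hee
    have hc : cond q := (Finset.mem_filter.mp (Finset.mem_coe.mp hq)).2
    have hc' : cond q' := (Finset.mem_filter.mp (Finset.mem_coe.mp hq')).2
    obtain ⟨h1, h2, r1, r2⟩ := q
    obtain ⟨h1', h2', r1', r2'⟩ := q'
    simp only [he, Prod.mk.injEq] at hee
    simp only [hcond] at hc hc'
    obtain ⟨⟨⟨g1, g2⟩, g3⟩, g4⟩ := hee
    have er1 : (r1:ℕ) = r1' := by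
      rw [← Nat.mul_div_cancel' (Nat.gcd_dvd_left (r1:ℕ) r2), g3, g2,
        Nat.mul_div_cancel' (Nat.gcd_dvd_left (r1':ℕ) r2')]
    have er2 : (r2:ℕ) = r2' := by
      rw [← Nat.mul_div_cancel' (Nat.gcd_dvd_right (r1:ℕ) r2), g4, g2,
        Nat.mul_div_cancel' (Nat.gcd_dvd_right (r1':ℕ) r2')]
    rw [← er1, ← er2] at hc'
    have hx : (h1:ℕ) ^ a * (h2':ℕ) ^ a = (h1':ℕ) ^ a * (h2:ℕ) ^ a := by
      have : ((r1:ℕ) ^ b * (r2:ℕ)^b) * ((h1:ℕ) ^ a * (h2':ℕ) ^ a) =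
        ((r1:ℕ) ^ b * (r2:ℕ)^b) * ((h1':ℕ) ^ a * (h2:ℕ) ^ a) := by
        calc _ = ((h1:ℕ) ^ a * (r1:ℕ) ^ b) * ((h2':ℕ) ^ a * (r2:ℕ)^b) := by ring
          _ = ((h2:ℕ) ^ a * (r2:ℕ) ^ b) * ((h1':ℕ) ^ a * (r1:ℕ)^b) := by rw [hc, hc']
          _ = _ := by ring
      have p1 := r1.pos
      have p2 := r2.pos
      exact Nat.eq_of_mul_eq_mul_left (by positivity) this
    rw [← mul_pow, ← mul_pow] at hx
    have hx2 : (h1:ℕ) * h2' = h1' * h2 := Nat.pow_left_injective (by omega : a ≠ 0) hx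
    obtain ⟨p, q, hpq, hp, hq⟩ := Nat.exists_coprime (h1:ℕ) h2
    obtain ⟨p', q', hpq', hp', hq'⟩ := Nat.exists_coprime (h1':ℕ) h2'
    have gpos : 0 < Nat.gcd (h1:ℕ) h2 := Nat.gcd_pos_of_pos_left _ h1.pos
    rw [← g1] at hp' hq'
    have hx3 : p * q' = p' * q := by
      clear g1 g2 g3 g4
      generalize Nat.gcd (h1:ℕ) h2 = g at *
      rw [hp, hq', hp', hq] at hx2
      have : (g * g) * (p * q') = (g * g) * (p' * q) := by
        linarith
      exact Nat.eq_of_mul_eq_mul_left (by positivity) this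
    have hfr : (p, q) = (p', q') := by
      by_contra hne
      exact frac_ne (y := (p, q)) (y' := (p', q')) hpq hpq' hne hx3
    simp only [Prod.mk.injEq] at hfr
    have eh1 : (h1:ℕ) = h1' := by rw [hp, hp', hfr.1]
    have eh2 : (h2:ℕ) = h2' := by rw [hq, hq', hfr.2]
    simp only [Prod.mk.injEq]
    exact ⟨PNat.eq eh1, PNat.eq eh2, PNat.eq er1, PNat.eq er2⟩
  refine h1.trans ?_
  rw [← Finset.mul_sum, ← Finset.sum_image (f := B) hinj]
  gcongr
  exact hs4.sum_le_tsum _ fun z _ => hB0 z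


lemma diag_tail (a b : ℕ) (ha : 1 ≤ a) (hab : a < b) :
    ∃ C : ℝ, 0 ≤ C ∧ ∀ H : ℝ, 2 ≤ H →
      |(∑ i ∈ Finset.Icc 1 ⌊(a:ℝ) * H⌋₊ ×ˢ Finset.Icc 1 ⌊(b:ℝ) * H⌋₊,
        ∑ j ∈ Finset.Icc 1 ⌊(a:ℝ) * H⌋₊ ×ˢ Finset.Icc 1 ⌊(b:ℝ) * H⌋₊,
          gterm a b i.1 j.1 i.2 j.2) - Gab a b| ≤ C * H ^ (-(a:ℝ) / (2 * ((a:ℝ) + b))) := by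
  classical
  have hψ := gsummable a b ha hab
  set f : ℕ+ × ℕ+ × ℕ+ × ℕ+ → ℝ := fun q => gterm a b q.1 q.2.1 q.2.2.1 q.2.2.2 with hf
  set μ : ℕ+ × ℕ+ × ℕ+ × ℕ+ → ℝ := fun q => gmu a b q.1 q.2.1 q.2.2.1 q.2.2.2 with hμ
  have A0 : (1:ℝ) ≤ a := by exact_mod_cast ha
  have B0 : (1:ℝ) ≤ b := by exact_mod_cast (by omega : 1 ≤ b)
  set δ : ℝ := (a:ℝ) / (2 * (a + b)) with hδ
  have hδ0 : 0 ≤ δ := by positivity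
  have hf0 : ∀ q, 0 ≤ f q := fun q => gterm_nonneg _ _ _ _ _ _
  have hone : ∀ n : ℕ+, 1 ≤ ((n:ℕ):ℝ) ^ δ := fun n =>
    Real.one_le_rpow (by exact_mod_cast n.pos) hδ0
  have hμ1 : ∀ q, 1 ≤ μ q := by
    intro q
    have := hone q.1; have := hone q.2.1; have := hone q.2.2.1; have := hone q.2.2.2
    simp only [hμ, gmu, ← hδ]; linarith
  have hfs : Summable f := by
    refine Summable.of_nonneg_of_le hf0 (fun q => ?_) hψ
    exact le_mul_of_one_le_right (hf0 q) (hμ1 q)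
  have hψ0 : ∀ q, 0 ≤ f q * μ q := fun q => mul_nonneg (hf0 q) (by linarith [hμ1 q])
  refine ⟨∑' q, f q * μ q, tsum_nonneg hψ0, ?_⟩
  intro H hH
  have hM : 1 ≤ ⌊(a:ℝ) * H⌋₊ := Nat.one_le_floor_iff _ |>.mpr (by nlinarith)
  have hN : 1 ≤ ⌊(b:ℝ) * H⌋₊ := Nat.one_le_floor_iff _ |>.mpr (by nlinarith)
  have hMlt : H < (⌊(a:ℝ) * H⌋₊ : ℝ) + 1 := by
    have := Nat.lt_floor_add_one ((a:ℝ) * H); nlinarith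
  have hNlt : H < (⌊(b:ℝ) * H⌋₊ : ℝ) + 1 := by
    have := Nat.lt_floor_add_one ((b:ℝ) * H); nlinarith
  set M := ⌊(a:ℝ) * H⌋₊
  set N := ⌊(b:ℝ) * H⌋₊
  set E : Finset (ℕ+ × ℕ+ × ℕ+ × ℕ+) := Finset.Icc 1 M.toPNat' ×ˢ Finset.Icc 1 M.toPNat' ×ˢ
    Finset.Icc 1 N.toPNat' ×ˢ Finset.Icc 1 N.toPNat' with hE
  have memM : ∀ (L : ℕ) (hL : 1 ≤ L) (n : ℕ+), n ∈ Finset.Icc 1 L.toPNat' ↔ (n:ℕ) ≤ L := by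
    intro L hL n
    rw [Finset.mem_Icc, ← PNat.coe_le_coe, ← PNat.coe_le_coe, Nat.toPNat'_coe, if_pos (by omega)]
    have := n.pos
    simp only [PNat.one_coe]; omega
  have hsum : ∑ i ∈ Finset.Icc 1 M ×ˢ Finset.Icc 1 N, ∑ j ∈ Finset.Icc 1 M ×ˢ Finset.Icc 1 N,
          gterm a b i.1 j.1 i.2 j.2 = ∑ q ∈ E, f q := by
    rw [← Finset.sum_product']
    symm
    refine Finset.sum_nbij' (fun q => (((q.1:ℕ), (q.2.2.1:ℕ)), ((q.2.1:ℕ), (q.2.2.2:ℕ))))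
      (fun z => (z.1.1.toPNat', z.2.1.toPNat', z.1.2.toPNat', z.2.2.toPNat')) ?_ ?_ ?_ ?_ ?_
    · intro q hq
      simp only [hE, Finset.mem_product, memM M hM, memM N hN] at hq
      simp only [Finset.mem_product, Finset.mem_Icc]
      have := q.1.pos; have := q.2.1.pos; have := q.2.2.1.pos; have := q.2.2.2.pos
      omega
    · intro z hz
      simp only [Finset.mem_product, Finset.mem_Icc] at hz
      simp only [hE, Finset.mem_product, memM M hM, memM N hN, Nat.toPNat'_coe]
      rw [if_pos (by omega), if_pos (by omega), if_pos (by omega), if_pos (by omega)]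
      omega
    · intro q hq
      simp
    · intro z hz
      simp only [Finset.mem_product, Finset.mem_Icc] at hz
      simp only [Nat.toPNat'_coe]
      rw [if_pos (by omega), if_pos (by omega), if_pos (by omega), if_pos (by omega)]
    · intro q hq; rfl
  rw [hsum, Gab_eq]
  have h1 : ∑ q ∈ E, f q ≤ ∑' q, f q := hfs.sum_le_tsum _ fun q _ => hf0 q
  have hH0 : 0 < H := by linarith
  have h2 : ∑' q, f q ≤ ∑ q ∈ E, f q + (∑' q, f q * μ q) * H ^ (-δ) := by
    have hs1 : HasSum (fun q => if q ∈ E then f q else 0) (∑ q ∈ E, f q) := by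
      have : HasSum (fun q => if q ∈ E then f q else 0) (∑ q ∈ E, if q ∈ E then f q else 0) :=
        hasSum_sum_of_ne_finset_zero (fun q hq => if_neg hq)
      convert this using 1
      exact Finset.sum_congr rfl fun q hq => (if_pos hq).symm
    have hs2 : HasSum (fun q => f q * μ q * H ^ (-δ)) ((∑' q, f q * μ q) * H ^ (-δ)) :=
      hψ.hasSum.mul_right _
    refine hasSum_le (fun q => ?_) hfs.hasSum (hs1.add hs2)
    by_cases hq : q ∈ E
    · simp only [if_pos hq]
      have : 0 ≤ f q * μ q * H ^ (-δ) := mul_nonneg (hψ0 q) (by positivity)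
      linarith
    · simp only [if_neg hq, zero_add]
      rw [mul_assoc]
      apply le_mul_of_one_le_right (hf0 q)
      rw [Real.rpow_neg hH0.le, ← div_eq_mul_inv, one_le_div (by positivity)]
      simp only [hE, Finset.mem_product, memM M hM, memM N hN] at hq
      have big : ∀ (L : ℕ) (n : ℕ+), H < (L:ℝ) + 1 → ¬ ((n:ℕ) ≤ L) → H ^ δ ≤ ((n:ℕ):ℝ) ^ δ := by
        intro L n h h'
        have : (L:ℝ) + 1 ≤ ((n:ℕ):ℝ) := by exact_mod_cast (by omega : L + 1 ≤ (n:ℕ))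
        exact Real.rpow_le_rpow hH0.le (by linarith) hδ0
      have t1 := hone q.1; have t2 := hone q.2.1; have t3 := hone q.2.2.1; have t4 := hone q.2.2.2
      have : H ^ δ ≤ ((q.1:ℕ):ℝ) ^ δ ∨ H ^ δ ≤ ((q.2.1:ℕ):ℝ) ^ δ ∨ H ^ δ ≤ ((q.2.2.1:ℕ):ℝ) ^ δ ∨ H ^ δ ≤ ((q.2.2.2:ℕ):ℝ) ^ δ := by
        by_contra hcon
        push Not at hcon
        apply hq
        refine ⟨?_, ?_, ?_, ?_⟩ <;> by_contra hh
        · exact absurd (big M _ hMlt hh) (not_le.mpr hcon.1)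
        · exact absurd (big M _ hMlt hh) (not_le.mpr hcon.2.1)
        · exact absurd (big N _ hNlt hh) (not_le.mpr hcon.2.2.1)
        · exact absurd (big N _ hNlt hh) (not_le.mpr hcon.2.2.2)
      simp only [hμ, gmu, ← hδ]
      rcases this with h | h | h | h <;> linarith
  rw [show -(a:ℝ) / (2 * ((a:ℝ) + b)) = -δ by rw [hδ, neg_div], abs_sub_comm, abs_of_nonneg (by linarith)]
  linarith

lemma osc (s lam ph T T₀ : ℝ) (hs : 0 < s) (hl : lam ≠ 0) (hT : 0 < T) (h0 : 0 < T₀) (h1 : T₀ ≤ T) :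
    |∫ x in T..(T + T₀), x ^ (1 / s) * Real.cos (lam * x ^ (1 / s) + ph)| ≤ 5 * s * T / |lam| := by
  have hmem : ∀ x ∈ Set.uIcc T (T + T₀), 0 < x := by
    intro x hx
    rw [Set.uIcc_of_le (by linarith)] at hx
    linarith [hx.1]
  have hcr : ContinuousOn (fun x : ℝ => x ^ (1 / s)) (Set.uIcc T (T + T₀)) := by
    intro x hx
    exact (Real.continuousAt_rpow_const x _ (Or.inl (hmem x hx).ne')).continuousWithinAt
  have hcA : ContinuousOn (fun x : ℝ => lam * x ^ (1 / s) + ph) (Set.uIcc T (T + T₀)) :=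
    (continuousOn_const.mul hcr).add continuousOn_const
  have i1 : IntervalIntegrable (fun x : ℝ => s / lam * Real.sin (lam * x ^ (1 / s) + ph)) volume T (T + T₀) :=
    (continuousOn_const.mul (Real.continuous_sin.comp_continuousOn hcA)).intervalIntegrable
  have i2 : IntervalIntegrable (fun x : ℝ => x ^ (1 / s) * Real.cos (lam * x ^ (1 / s) + ph)) volume T (T + T₀) :=
    (hcr.mul (Real.continuous_cos.comp_continuousOn hcA)).intervalIntegrable
  have hder : ∀ x ∈ Set.uIcc T (T + T₀), HasDerivAt
      (fun x : ℝ => s / lam * (x * Real.sin (lam * x ^ (1 / s) + ph)))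
      (s / lam * Real.sin (lam * x ^ (1 / s) + ph) + x ^ (1 / s) * Real.cos (lam * x ^ (1 / s) + ph)) x := by
    intro x hx
    have hx0 := hmem x hx
    have d1 := Real.hasDerivAt_rpow_const (x := x) (p := 1 / s) (Or.inl hx0.ne')
    have d2 := (((d1.const_mul lam).add_const ph).sin)
    have d3 := ((hasDerivAt_id x).mul d2).const_mul (s / lam)
    refine d3.congr_deriv ?_
    have e : x ^ (1 / s - 1) = x ^ (1 / s) / x := by
      rw [Real.rpow_sub hx0, Real.rpow_one]
    simp only [id]
    rw [e]; field_simp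
  have hI := intervalIntegral.integral_eq_sub_of_hasDerivAt hder (i1.add i2)
  rw [intervalIntegral.integral_add i1 i2] at hI
  have b1 : |∫ x in T..(T + T₀), s / lam * Real.sin (lam * x ^ (1 / s) + ph)| ≤ s / |lam| * T₀ := by
    have := intervalIntegral.norm_integral_le_of_norm_le_const (a := T) (b := T + T₀) (C := s / |lam|)
      (f := fun x : ℝ => s / lam * Real.sin (lam * x ^ (1 / s) + ph)) (by
        intro x _
        rw [Real.norm_eq_abs, abs_mul, abs_div, abs_of_pos hs]
        exact mul_le_of_le_one_right (by positivity) (Real.abs_sin_le_one _))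
    rw [Real.norm_eq_abs, show T + T₀ - T = T₀ by ring, abs_of_pos h0] at this
    exact this
  have b2 : ∀ x : ℝ, 0 < x → |s / lam * (x * Real.sin (lam * x ^ (1 / s) + ph))| ≤ s / |lam| * x := by
    intro x hx
    rw [abs_mul, abs_mul, abs_div, abs_of_pos hs, abs_of_pos hx]
    gcongr
    exact mul_le_of_le_one_right hx.le (Real.abs_sin_le_one _)
  have b3 := b2 T hT
  have b4 := b2 (T + T₀) (by linarith)
  have hk : 0 ≤ s / |lam| := by positivity
  have e5 : 5 * s * T / |lam| = s / |lam| * (5 * T) := by ring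
  rw [e5]
  rw [abs_le] at b1 b3 b4 ⊢
  have : s / |lam| * T₀ ≤ s / |lam| * T := by gcongr
  constructor <;> nlinarith

lemma triv_int (s lam ph T T₀ : ℝ) (hs : 1 ≤ s) (hT : 0 < T) (h0 : 0 < T₀) (h1 : T₀ ≤ T) :
    |∫ x in T..(T + T₀), x ^ (1 / s) * Real.cos (lam * x ^ (1 / s) + ph)| ≤ 2 * T * T ^ (1 / s) := by
  have := intervalIntegral.norm_integral_le_of_norm_le_const (a := T) (b := T + T₀) (C := 2 * T ^ (1 / s))
      (f := fun x : ℝ => x ^ (1 / s) * Real.cos (lam * x ^ (1 / s) + ph)) (by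
        intro x hx
        rw [Set.uIoc_of_le (by linarith)] at hx
        have hx0 : 0 < x := by linarith [hx.1]
        rw [Real.norm_eq_abs, abs_mul, abs_of_nonneg (by positivity : 0 ≤ x ^ (1 / s))]
        refine (mul_le_of_le_one_right (by positivity) (Real.abs_cos_le_one _)).trans ?_
        calc x ^ (1 / s) ≤ (2 * T) ^ (1 / s) :=
              Real.rpow_le_rpow hx0.le (by linarith [hx.2]) (by positivity)
          _ = 2 ^ (1 / s) * T ^ (1 / s) := Real.mul_rpow (by norm_num) hT.le
          _ ≤ 2 * T ^ (1 / s) := by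
            gcongr
            calc (2:ℝ) ^ (1 / s) ≤ 2 ^ (1:ℝ) := Real.rpow_le_rpow_of_exponent_le (by norm_num)
                  (by rw [div_le_one (by linarith)]; exact hs)
              _ = 2 := Real.rpow_one 2)
  rw [Real.norm_eq_abs, show T + T₀ - T = T₀ by ring, abs_of_pos h0] at this
  refine this.trans ?_
  have : 2 * T ^ (1 / s) * T₀ ≤ 2 * T ^ (1 / s) * T := by gcongr
  linarith

lemma logmean_aux (u v : ℝ) (hv : 0 < v) (h : v ≤ u) :
    √(u * v) * (Real.log u - Real.log v) ≤ u - v := by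
  have hu : 0 < u := by linarith
  set t := (Real.log u - Real.log v) / 2 with ht
  have ht0 : 0 ≤ t := by have := Real.log_le_log hv h; rw [ht]; linarith
  have h1 := Real.self_le_sinh_iff.mpr ht0
  rw [Real.sinh_eq] at h1
  have e0 : √(u * v) = Real.exp ((Real.log u + Real.log v) / 2) := by
    rw [Real.sqrt_eq_rpow, Real.rpow_def_of_pos (by positivity), Real.log_mul hu.ne' hv.ne']
    congr 1; ring
  have e1 : √(u * v) * Real.exp t = u := by
    rw [e0, ← Real.exp_add, ht]
    rw [show (Real.log u + Real.log v) / 2 + (Real.log u - Real.log v) / 2 = Real.log u by ring, Real.exp_log hu]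
  have e2 : √(u * v) * Real.exp (-t) = v := by
    rw [e0, ← Real.exp_add, ht]
    rw [show (Real.log u + Real.log v) / 2 + -((Real.log u - Real.log v) / 2) = Real.log v by ring, Real.exp_log hv]
  have h3 : √(u * v) * (Real.log u - Real.log v) ≤ √(u * v) * (Real.exp t - Real.exp (-t)) := by
    apply mul_le_mul_of_nonneg_left _ (by positivity)
    linarith
  rw [mul_sub _ (Real.exp t), e1, e2] at h3
  exact h3

lemma logmean (u v : ℝ) (hu : 0 < u) (hv : 0 < v) :
    √(u * v) * |Real.log u - Real.log v| ≤ |u - v| := by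
  rcases le_total v u with h | h
  · rw [abs_of_nonneg (sub_nonneg.mpr (Real.log_le_log hv h)), abs_of_nonneg (sub_nonneg.mpr h)]
    exact logmean_aux u v hv h
  · rw [abs_sub_comm, abs_sub_comm u, abs_of_nonneg (sub_nonneg.mpr (Real.log_le_log hu h)), abs_of_nonneg (sub_nonneg.mpr h), mul_comm u]
    exact logmean_aux v u hu h


noncomputable def nn (a b : ℕ) (i : ℕ × ℕ) : ℝ :=
  ((i.1:ℝ) ^ (a:ℝ) * (i.2:ℝ) ^ (b:ℝ)) ^ (1 / ((a:ℝ) + b))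

noncomputable def ww (a b : ℕ) (i : ℕ × ℕ) : ℝ :=
  (i.1:ℝ) ^ (-((a:ℝ) + 2 * b) / (2 * ((a:ℝ) + b))) * (i.2:ℝ) ^ (-(2 * (a:ℝ) + b) / (2 * ((a:ℝ) + b)))

noncomputable def PP (a b : ℕ) (x y : ℕ × ℕ) : ℝ :=
  (((x.1:ℝ) * x.2) ^ a * ((y.1:ℝ) * y.2) ^ b) ^ (1 / (2 * ((a:ℝ) + b)))

lemma nn_pos (a b : ℕ) (i : ℕ × ℕ) (h1 : 1 ≤ i.1) (h2 : 1 ≤ i.2) : 0 < nn a b i := by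
  have : (0:ℝ) < i.1 := by exact_mod_cast h1
  have : (0:ℝ) < i.2 := by exact_mod_cast h2
  unfold nn; positivity

lemma PP_pos (a b : ℕ) (i j : ℕ × ℕ) (h1 : 1 ≤ i.1) (h2 : 1 ≤ i.2) (h3 : 1 ≤ j.1) (h4 : 1 ≤ j.2) :
    0 < PP a b i j := by
  have : (0:ℝ) < i.1 := by exact_mod_cast h1
  have : (0:ℝ) < i.2 := by exact_mod_cast h2
  have : (0:ℝ) < j.1 := by exact_mod_cast h3
  have : (0:ℝ) < j.2 := by exact_mod_cast h4
  unfold PP; positivity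

lemma ww_nonneg (a b : ℕ) (i : ℕ × ℕ) : 0 ≤ ww a b i := by
  unfold ww; positivity

lemma log_nn (a b : ℕ) (i : ℕ × ℕ) (h1 : 1 ≤ i.1) (h2 : 1 ≤ i.2) :
    Real.log (nn a b i) = (a * Real.log i.1 + b * Real.log i.2) / ((a:ℝ) + b) := by
  have h1 : (0:ℝ) < i.1 := by exact_mod_cast h1
  have h2 : (0:ℝ) < i.2 := by exact_mod_cast h2
  unfold nn
  rw [Real.log_rpow (by positivity), Real.log_mul (by positivity) (by positivity),
    Real.log_rpow h1, Real.log_rpow h2]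
  ring

lemma log_PP (a b : ℕ) (i j : ℕ × ℕ) (h1 : 1 ≤ i.1) (h2 : 1 ≤ i.2) (h3 : 1 ≤ j.1) (h4 : 1 ≤ j.2) :
    Real.log (PP a b i j) = (a * (Real.log i.1 + Real.log i.2) + b * (Real.log j.1 + Real.log j.2)) / (2 * ((a:ℝ) + b)) := by
  have h1 : (0:ℝ) < i.1 := by exact_mod_cast h1
  have h2 : (0:ℝ) < i.2 := by exact_mod_cast h2
  have h3 : (0:ℝ) < j.1 := by exact_mod_cast h3
  have h4 : (0:ℝ) < j.2 := by exact_mod_cast h4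
  unfold PP
  rw [Real.log_rpow (by positivity), Real.log_mul (by positivity) (by positivity),
    Real.log_pow, Real.log_pow, Real.log_mul h1.ne' h2.ne', Real.log_mul h3.ne' h4.ne']
  ring

lemma ww_mul (a b : ℕ) (ha : 1 ≤ a) (h1 h2 r1 r2 : ℕ) (p1 : 1 ≤ h1) (p2 : 1 ≤ h2) (p3 : 1 ≤ r1) (p4 : 1 ≤ r2) :
    ww a b (h1, r1) * ww a b (h2, r2) =
      1 / ((h1:ℝ) * h2) * (1 / ((r1:ℝ) * r2)) * PP a b (h1, h2) (r1, r2) := by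
  have q1 : (0:ℝ) < h1 := by exact_mod_cast p1
  have q2 : (0:ℝ) < h2 := by exact_mod_cast p2
  have q3 : (0:ℝ) < r1 := by exact_mod_cast p3
  have q4 : (0:ℝ) < r2 := by exact_mod_cast p4
  have A0 : (1:ℝ) ≤ a := by exact_mod_cast ha
  have hP := PP_pos a b (h1, h2) (r1, r2) p1 p2 p3 p4
  apply Real.log_injOn_pos
  · simp only [Set.mem_Ioi, ww]; positivity
  · simp only [Set.mem_Ioi]; positivity
  · unfold ww
    rw [Real.log_mul (by positivity) (by positivity), Real.log_mul (by positivity) (by positivity),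
      Real.log_mul (by positivity) (by positivity), Real.log_rpow q1, Real.log_rpow q2, Real.log_rpow q3,
      Real.log_rpow q4, Real.log_mul (by positivity) (by positivity), Real.log_mul (by positivity) (by positivity),
      log_PP a b _ _ p1 p2 p3 p4, one_div, one_div, Real.log_inv, Real.log_inv, Real.log_mul q1.ne' q2.ne', Real.log_mul q3.ne' q4.ne']
    field_simp
    ring

lemma sqrt_nn (a b : ℕ) (h1 h2 r1 r2 : ℕ) (p1 : 1 ≤ h1) (p2 : 1 ≤ h2) (p3 : 1 ≤ r1) (p4 : 1 ≤ r2) :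
    √(nn a b (h1, r1) * nn a b (h2, r2)) = PP a b (h1, h2) (r1, r2) := by
  have n1 := nn_pos a b (h1, r1) p1 p3
  have n2 := nn_pos a b (h2, r2) p2 p4
  have hP := PP_pos a b (h1, h2) (r1, r2) p1 p2 p3 p4
  apply Real.log_injOn_pos
  · simp only [Set.mem_Ioi]; positivity
  · exact hP
  · rw [Real.log_sqrt (by positivity), Real.log_mul n1.ne' n2.ne', log_nn a b _ p1 p3, log_nn a b _ p2 p4,
      log_PP a b _ _ p1 p2 p3 p4, mul_comm 2 ((a:ℝ) + b), ← div_div]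
    ring

lemma nn_log_sub (a b : ℕ) (h1 h2 r1 r2 : ℕ) (p1 : 1 ≤ h1) (p2 : 1 ≤ h2) (p3 : 1 ≤ r1) (p4 : 1 ≤ r2) :
    Real.log (nn a b (h1, r1)) - Real.log (nn a b (h2, r2)) = LL a b (h1, h2) (r1, r2) / ((a:ℝ) + b) := by
  rw [log_nn a b _ p1 p3, log_nn a b _ p2 p4]
  simp only [LL]
  ring

lemma nn_sub_ge (a b : ℕ) (h1 h2 r1 r2 : ℕ) (p1 : 1 ≤ h1) (p2 : 1 ≤ h2) (p3 : 1 ≤ r1) (p4 : 1 ≤ r2) :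
    PP a b (h1, h2) (r1, r2) * (|LL a b (h1, h2) (r1, r2)| / ((a:ℝ) + b)) ≤
      |nn a b (h1, r1) - nn a b (h2, r2)| := by
  have := logmean _ _ (nn_pos a b (h1, r1) p1 p3) (nn_pos a b (h2, r2) p2 p4)
  rw [sqrt_nn a b h1 h2 r1 r2 p1 p2 p3 p4, nn_log_sub a b h1 h2 r1 r2 p1 p2 p3 p4, abs_div,
    abs_of_nonneg (by positivity : (0:ℝ) ≤ (a:ℝ) + b)] at this
  exact this

lemma nn_add_ge (a b : ℕ) (h1 h2 r1 r2 : ℕ) (p1 : 1 ≤ h1) (p2 : 1 ≤ h2) (p3 : 1 ≤ r1) (p4 : 1 ≤ r2) :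
    PP a b (h1, h2) (r1, r2) ≤ nn a b (h1, r1) + nn a b (h2, r2) := by
  have n1 := nn_pos a b (h1, r1) p1 p3
  have n2 := nn_pos a b (h2, r2) p2 p4
  rw [← sqrt_nn a b h1 h2 r1 r2 p1 p2 p3 p4]
  apply Real.sqrt_le_iff.mpr ⟨by positivity, by nlinarith⟩

lemma nn_eq_iff (a b : ℕ) (ha : 1 ≤ a) (h1 h2 r1 r2 : ℕ) :
    nn a b (h1, r1) = nn a b (h2, r2) ↔ h1 ^ a * r1 ^ b = h2 ^ a * r2 ^ b := by
  unfold nn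
  have A0 : (1:ℝ) ≤ a := by exact_mod_cast ha
  rw [Real.rpow_left_inj (by positivity) (by positivity) (by positivity)]
  simp only [Real.rpow_natCast]
  exact_mod_cast Iff.rfl

lemma gterm_eq (a b : ℕ) (h1 h2 r1 r2 : ℕ) :
    gterm a b h1 h2 r1 r2 = if h1 ^ a * r1 ^ b = h2 ^ a * r2 ^ b then
      ww a b (h1, r1) * ww a b (h2, r2) else 0 := by
  unfold gterm ww
  congr 1
  rw [Real.mul_rpow (by positivity) (by positivity), Real.mul_rpow (by positivity) (by positivity)]
  ring

lemma c2_pos (a b : ℕ) (ha : 1 ≤ a) (hb : 1 ≤ b) : 0 < c2 a b := by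
  have A0 : (1:ℝ) ≤ a := by exact_mod_cast ha
  have B0 : (1:ℝ) ≤ b := by exact_mod_cast hb
  unfold c2; positivity

/-- minus and plus oscillatory integrals -/
noncomputable def Im (a b : ℕ) (T T₀ : ℝ) (i j : ℕ × ℕ) : ℝ :=
  ∫ x in T..(T + T₀), x ^ (1 / ((a:ℝ) + b)) *
    Real.cos (2 * π * c2 a b * (nn a b i - nn a b j) * x ^ (1 / ((a:ℝ) + b)) + 0)

noncomputable def Ip (a b : ℕ) (T T₀ : ℝ) (i j : ℕ × ℕ) : ℝ :=
  ∫ x in T..(T + T₀), x ^ (1 / ((a:ℝ) + b)) *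
    Real.cos (2 * π * c2 a b * (nn a b i + nn a b j) * x ^ (1 / ((a:ℝ) + b)) + -(π / 2))

lemma Delta_sq (a b : ℕ) (H x : ℝ) (ha : 1 ≤ a) (hx : 0 < x) :
    (DeltaStar a b H x) ^ 2 = (c1 a b) ^ 2 / (2 * π ^ 2) *
      ∑ i ∈ Finset.Icc 1 ⌊(a:ℝ) * H⌋₊ ×ˢ Finset.Icc 1 ⌊(b:ℝ) * H⌋₊,
        ∑ j ∈ Finset.Icc 1 ⌊(a:ℝ) * H⌋₊ ×ˢ Finset.Icc 1 ⌊(b:ℝ) * H⌋₊,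
          ww a b i * ww a b j * (
            x ^ (1 / ((a:ℝ) + b)) * Real.cos (2 * π * c2 a b * (nn a b i - nn a b j) * x ^ (1 / ((a:ℝ) + b)) + 0) +
            x ^ (1 / ((a:ℝ) + b)) * Real.cos (2 * π * c2 a b * (nn a b i + nn a b j) * x ^ (1 / ((a:ℝ) + b)) + -(π / 2))) := by
  have A0 : (1:ℝ) ≤ a := by exact_mod_cast ha
  have hD : DeltaStar a b H x = (c1 a b / π) * x ^ (1 / (2 * ((a:ℝ) + b))) *
      ∑ i ∈ Finset.Icc 1 ⌊(a:ℝ) * H⌋₊ ×ˢ Finset.Icc 1 ⌊(b:ℝ) * H⌋₊,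
        ww a b i * Real.cos (2 * π * c2 a b * x ^ (1 / ((a:ℝ) + b)) * nn a b i - π / 4) := by
    rw [Finset.sum_product]
    rfl
  have hx2 : x ^ (1 / ((a:ℝ) + b)) = x ^ (1 / (2 * ((a:ℝ) + b))) * x ^ (1 / (2 * ((a:ℝ) + b))) := by
    rw [← Real.rpow_add hx]; congr 1; field_simp; ring
  rw [hD, mul_pow, sq (Finset.sum _ _), Finset.sum_mul_sum, Finset.mul_sum, Finset.mul_sum]
  refine Finset.sum_congr rfl fun i _ => ?_
  rw [Finset.mul_sum, Finset.mul_sum]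
  refine Finset.sum_congr rfl fun j _ => ?_
  set X := x ^ (1 / ((a:ℝ) + b)) with hX
  set u := 2 * π * c2 a b * X * nn a b i - π / 4 with hu
  set v := 2 * π * c2 a b * X * nn a b j - π / 4 with hv
  have e1 : 2 * π * c2 a b * (nn a b i - nn a b j) * X + 0 = u - v := by rw [hu, hv]; ring
  have e2 : 2 * π * c2 a b * (nn a b i + nn a b j) * X + -(π / 2) = u + v := by rw [hu, hv]; ring
  clear_value u v
  rw [e1, e2, Real.cos_sub, Real.cos_add]
  have hpi := Real.pi_pos
  have : (c1 a b / π * x ^ (1 / (2 * ((a:ℝ) + b)))) ^ 2 = c1 a b ^ 2 / π ^ 2 * X := by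
    rw [hx2]; ring
  rw [this]
  field_simp
  ring

lemma int_Delta_sq (a b : ℕ) (H T T₀ : ℝ) (ha : 1 ≤ a) (hT : 0 < T) (h0 : 0 < T₀) :
    ∫ x in T..(T + T₀), (DeltaStar a b H x) ^ 2 = (c1 a b) ^ 2 / (2 * π ^ 2) *
      ∑ i ∈ Finset.Icc 1 ⌊(a:ℝ) * H⌋₊ ×ˢ Finset.Icc 1 ⌊(b:ℝ) * H⌋₊,
        ∑ j ∈ Finset.Icc 1 ⌊(a:ℝ) * H⌋₊ ×ˢ Finset.Icc 1 ⌊(b:ℝ) * H⌋₊,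
          ww a b i * ww a b j * (Im a b T T₀ i j + Ip a b T T₀ i j) := by
  have hmem : ∀ x ∈ Set.uIcc T (T + T₀), 0 < x := by
    intro x hx
    rw [Set.uIcc_of_le (by linarith)] at hx
    linarith [hx.1]
  rw [intervalIntegral.integral_congr fun x hx => Delta_sq a b H x ha (hmem x hx)]
  have hcr : ContinuousOn (fun x : ℝ => x ^ (1 / ((a:ℝ) + b))) (Set.uIcc T (T + T₀)) :=
    fun x hx => (Real.continuousAt_rpow_const _ _ (Or.inl (hmem x hx).ne')).continuousWithinAt
  have hcc : ∀ l p : ℝ, ContinuousOn (fun x : ℝ => x ^ (1 / ((a:ℝ) + b)) *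
      Real.cos (l * x ^ (1 / ((a:ℝ) + b)) + p)) (Set.uIcc T (T + T₀)) := fun l p =>
    (hcr.mul (Real.continuous_cos.comp_continuousOn ((hcr.const_mul l).add continuousOn_const)))
  have hci : ∀ l p : ℝ, IntervalIntegrable (fun x : ℝ => x ^ (1 / ((a:ℝ) + b)) *
      Real.cos (l * x ^ (1 / ((a:ℝ) + b)) + p)) volume T (T + T₀) := fun l p =>
    (hcc l p).intervalIntegrable
  rw [intervalIntegral.integral_const_mul, intervalIntegral.integral_finsetSum]
  · congr 1
    refine Finset.sum_congr rfl fun i _ => ?_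
    rw [intervalIntegral.integral_finsetSum]
    · refine Finset.sum_congr rfl fun j _ => ?_
      rw [intervalIntegral.integral_const_mul, intervalIntegral.integral_add (hci _ _) (hci _ _)]
      rfl
    · intro j _
      exact ((hci _ _).add (hci _ _)).const_mul _
  · intro i _
    apply ContinuousOn.intervalIntegrable
    apply continuousOn_finsetSum
    intro j _
    exact ((hcc _ _).add (hcc _ _)).const_mul _


lemma Im_off (a b : ℕ) (ha : 1 ≤ a) (hb : 1 ≤ b) (T T₀ : ℝ) (hT : 0 < T) (h0 : 0 < T₀) (h1T : T₀ ≤ T)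
    (h1 h2 r1 r2 : ℕ) (p1 : 1 ≤ h1) (p2 : 1 ≤ h2) (p3 : 1 ≤ r1) (p4 : 1 ≤ r2)
    (hne : h1 ^ a * r1 ^ b ≠ h2 ^ a * r2 ^ b) :
    ww a b (h1, r1) * ww a b (h2, r2) * |Im a b T T₀ (h1, r1) (h2, r2)| ≤
      (2 + 5 * ((a:ℝ) + b) ^ 2 / (2 * π * c2 a b)) * T * EE a b (T ^ (1 / ((a:ℝ) + b))) (h1, h2) (r1, r2) := by
  have A0 : (1:ℝ) ≤ a := by exact_mod_cast ha
  have B0 : (1:ℝ) ≤ b := by exact_mod_cast hb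
  have hc := c2_pos a b ha hb
  have hP := PP_pos a b (h1, h2) (r1, r2) p1 p2 p3 p4
  have hnn : nn a b (h1, r1) ≠ nn a b (h2, r2) := fun h => hne ((nn_eq_iff a b ha h1 h2 r1 r2).mp h)
  have hge := nn_sub_ge a b h1 h2 r1 r2 p1 p2 p3 p4
  have hL : LL a b (h1, h2) (r1, r2) ≠ 0 := by
    intro h
    have := nn_log_sub a b h1 h2 r1 r2 p1 p2 p3 p4
    rw [h, zero_div, sub_eq_zero] at this
    exact hnn (Real.log_injOn_pos (nn_pos a b (h1, r1) p1 p3) (nn_pos a b (h2, r2) p2 p4) this)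
  have hL' := abs_pos.mpr hL
  have hlam : 2 * π * c2 a b * (nn a b (h1, r1) - nn a b (h2, r2)) ≠ 0 := by
    have := sub_ne_zero.mpr hnn
    have := Real.pi_pos
    positivity
  have o1 := osc ((a:ℝ) + b) _ 0 T T₀ (by positivity) hlam hT h0 h1T
  have o2 := triv_int ((a:ℝ) + b) (2 * π * c2 a b * (nn a b (h1, r1) - nn a b (h2, r2))) 0 T T₀ (by linarith) hT h0 h1T
  change |Im a b T T₀ (h1, r1) (h2, r2)| ≤ _ at o1
  change |Im a b T T₀ (h1, r1) (h2, r2)| ≤ _ at o2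
  rw [ww_mul a b ha h1 h2 r1 r2 p1 p2 p3 p4]
  simp only [EE]
  set Q := 1 / ((h1:ℝ) * h2) * (1 / ((r1:ℝ) * r2)) with hQ
  have hQ0 : 0 ≤ Q := by positivity
  set P := PP a b (h1, h2) (r1, r2) with hPd
  set V := T ^ (1 / ((a:ℝ) + b)) with hV
  have hV0 : 0 < V := by positivity
  set I := |Im a b T T₀ (h1, r1) (h2, r2)| with hI
  set κ := 5 * ((a:ℝ) + b) ^ 2 / (2 * π * c2 a b) with hκ
  have hpi := Real.pi_pos
  have hκ0 : 0 ≤ κ := by positivity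
  have hM : MM a b V (h1, h2) (r1, r2) = min (V * P) (1 / |LL a b (h1, h2) (r1, r2)|) := rfl
  set ℓ := |LL a b (h1, h2) (r1, r2)| with hℓ
  have key : P * I ≤ (2 + κ) * T * MM a b V (h1, h2) (r1, r2) := by
    rw [hM, mul_min_of_nonneg _ _ (by positivity)]
    apply le_min
    · calc P * I ≤ P * (2 * T * V) := by gcongr
        _ = 2 * T * (V * P) := by ring
        _ ≤ (2 + κ) * T * (V * P) := by gcongr; linarith
    · calc P * I ≤ P * (5 * ((a:ℝ) + b) * T / |2 * π * c2 a b * (nn a b (h1, r1) - nn a b (h2, r2))|) := by gcongr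
        _ ≤ P * (5 * ((a:ℝ) + b) * T / (2 * π * c2 a b * (P * (ℓ / ((a:ℝ) + b))))) := by
          rw [abs_mul, abs_of_pos (by positivity : 0 < 2 * π * c2 a b)]
          gcongr
        _ = κ * T * (1 / ℓ) := by
          rw [hκ]; field_simp
        _ ≤ (2 + κ) * T * (1 / ℓ) := by gcongr; linarith
  calc Q * P * I = Q * (P * I) := by ring
    _ ≤ Q * ((2 + κ) * T * MM a b V (h1, h2) (r1, r2)) := by gcongr
    _ = _ := by ring

lemma Ip_bd (a b : ℕ) (ha : 1 ≤ a) (hb : 1 ≤ b) (T T₀ : ℝ) (hT : 0 < T) (h0 : 0 < T₀) (h1T : T₀ ≤ T)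
    (h1 h2 r1 r2 : ℕ) (p1 : 1 ≤ h1) (p2 : 1 ≤ h2) (p3 : 1 ≤ r1) (p4 : 1 ≤ r2) :
    ww a b (h1, r1) * ww a b (h2, r2) * |Ip a b T T₀ (h1, r1) (h2, r2)| ≤
      (5 * ((a:ℝ) + b) / (2 * π * c2 a b)) * T * (1 / ((h1:ℝ) * h2) * (1 / ((r1:ℝ) * r2))) := by
  have A0 : (1:ℝ) ≤ a := by exact_mod_cast ha
  have B0 : (1:ℝ) ≤ b := by exact_mod_cast hb
  have hc := c2_pos a b ha hb
  have hP := PP_pos a b (h1, h2) (r1, r2) p1 p2 p3 p4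
  have hge := nn_add_ge a b h1 h2 r1 r2 p1 p2 p3 p4
  have hpi := Real.pi_pos
  have n1 := nn_pos a b (h1, r1) p1 p3
  have n2 := nn_pos a b (h2, r2) p2 p4
  have hlam : 0 < 2 * π * c2 a b * (nn a b (h1, r1) + nn a b (h2, r2)) := by positivity
  have o1 := osc ((a:ℝ) + b) _ (-(π / 2)) T T₀ (by positivity) hlam.ne' hT h0 h1T
  change |Ip a b T T₀ (h1, r1) (h2, r2)| ≤ _ at o1
  rw [ww_mul a b ha h1 h2 r1 r2 p1 p2 p3 p4]
  set Q := 1 / ((h1:ℝ) * h2) * (1 / ((r1:ℝ) * r2)) with hQ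
  have hQ0 : 0 ≤ Q := by positivity
  set P := PP a b (h1, h2) (r1, r2) with hPd
  rw [abs_of_pos hlam] at o1
  calc Q * P * |Ip a b T T₀ (h1, r1) (h2, r2)| ≤ Q * P * (5 * ((a:ℝ) + b) * T / (2 * π * c2 a b * P)) := by
        refine mul_le_mul_of_nonneg_left (o1.trans ?_) (by positivity)
        gcongr
    _ = _ := by field_simp

lemma sum_reorder (f : ℕ × ℕ → ℕ × ℕ → ℝ) (hf : ∀ x y, 0 ≤ f x y) (M K : ℕ) (hM : M ≤ K) :
    ∑ i ∈ Finset.Icc 1 M ×ˢ Finset.Icc 1 K, ∑ j ∈ Finset.Icc 1 M ×ˢ Finset.Icc 1 K,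
      f (i.1, j.1) (i.2, j.2) ≤ ∑ x ∈ Sq K, ∑ y ∈ Sq K, f x y := by
  have hsub : Finset.Icc 1 M ×ˢ Finset.Icc 1 K ⊆ Sq K :=
    Finset.product_subset_product (Finset.Icc_subset_Icc le_rfl hM) le_rfl
  calc _ ≤ ∑ i ∈ Sq K, ∑ j ∈ Sq K, f (i.1, j.1) (i.2, j.2) := by
        refine (Finset.sum_le_sum fun i _ => Finset.sum_le_sum_of_subset_of_nonneg hsub
          fun j _ _ => hf _ _).trans ?_
        exact Finset.sum_le_sum_of_subset_of_nonneg hsub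
          fun j _ _ => Finset.sum_nonneg fun _ _ => hf _ _
    _ = _ := by
      unfold Sq
      simp only [Finset.sum_product]
      exact Finset.sum_congr rfl fun i _ => Finset.sum_comm

set_option maxHeartbeats 2000000 in
lemma final_aux (a b : ℕ) (ha : 1 ≤ a) (hab : a < b) (A : ℝ) (hA : 0 < A) :
    ∃ C > (0 : ℝ), ∀ T T₀ H : ℝ, 10 ≤ T → 0 < T₀ → T₀ ≤ T →
      2 ≤ H → H ≤ T ^ A →
      |(∫ x in T..(T + T₀), (DeltaStar a b H x) ^ 2) -
          (c1 a b) ^ 2 / (2 * π ^ 2) * Gab a b *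
            ∫ x in T..(T + T₀), x ^ (1 / ((a : ℝ) + b))| ≤
        C * (T ^ (1 + 1 / ((a : ℝ) + b)) * H ^ (-(a : ℝ) / (2 * ((a : ℝ) + b))) *
            (Real.log T) ^ 2 +
          T ^ (1 + 1 / ((a : ℝ) + b) -
              (a : ℝ) / (b * ((a : ℝ) + b) * ((a : ℝ) + b - 1))) *
            (Real.log T) ^ 4) := by
  have hb : 1 ≤ b := by omega
  have A0 : (1:ℝ) ≤ a := by exact_mod_cast ha
  have B0 : (a:ℝ) + 1 ≤ b := by exact_mod_cast hab
  have hpi := Real.pi_pos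
  have hc := c2_pos a b ha hb
  obtain ⟨C3, hC3, off⟩ := off_sum a b ha hb (by omega)
  obtain ⟨C4, hC4, tail⟩ := diag_tail a b ha hab
  set κ := 2 + 5 * ((a:ℝ) + b) ^ 2 / (2 * π * c2 a b) with hκ
  have hκ0 : 0 ≤ κ := by positivity
  set κ' := 5 * ((a:ℝ) + b) / (2 * π * c2 a b) with hκ'
  have hκ'0 : 0 ≤ κ' := by positivity
  set B := 1 + Real.log b + A with hB
  have hlb : 0 ≤ Real.log b := Real.log_nonneg (by linarith)
  have hB0 : 0 ≤ B := by positivity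
  set E1 := κ * C3 * B ^ 3 * (1 + B) + κ' * B ^ 4 with hE1
  have hE10 : 0 ≤ E1 := by positivity
  set c0 := (c1 a b) ^ 2 / (2 * π ^ 2) with hc0
  have hc00 : 0 ≤ c0 := by positivity
  refine ⟨c0 * (E1 + 2 * C4) + 1, by positivity, ?_⟩
  intro T T₀ H hT10 hT0 hTT hH hHT
  have hT : 0 < T := by linarith
  have hT1 : 1 ≤ T := by linarith
  rw [int_Delta_sq a b H T T₀ ha hT hT0]
  set s : ℝ := (a:ℝ) + b with hs
  have hs3 : 3 ≤ s := by linarith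
  set L := Real.log T with hLd
  have hL1 : 1 ≤ L := by
    rw [hLd, Real.le_log_iff_exp_le hT]
    have := Real.exp_one_lt_d9
    linarith
  set V := T ^ (1 / s) with hV
  have hV0 : 0 < V := by positivity
  set W := T ^ (1 + 1 / s - (a : ℝ) / (b * s * (s - 1))) with hW
  have hW0 : 0 < W := by positivity
  set J := ∫ x in T..(T + T₀), x ^ (1 / s) with hJ
  have hJb : |J| ≤ 2 * T * V := by
    have := triv_int s 0 0 T T₀ (by linarith) hT hT0 hTT
    simpa [hJ, hV] using this
  set K := ⌊(b:ℝ) * H⌋₊ with hK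
  set M := ⌊(a:ℝ) * H⌋₊ with hM
  have hMK : M ≤ K := Nat.floor_le_floor (by gcongr)
  have hK1 : 1 ≤ K := Nat.le_floor (by push_cast; nlinarith)
  have hKlog : 1 + Real.log K ≤ B * L := by
    have h1 : (K:ℝ) ≤ b * H := Nat.floor_le (by positivity)
    have h2 : Real.log K ≤ Real.log b + A * L := by
      calc Real.log K ≤ Real.log (b * T ^ A) := by
            apply Real.log_le_log (by exact_mod_cast hK1)
            exact h1.trans (by gcongr)
        _ = _ := by rw [Real.log_mul (by positivity) (by positivity), Real.log_rpow hT]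
    have h3 : (1 + Real.log b) * 1 ≤ (1 + Real.log b) * L :=
      mul_le_mul_of_nonneg_left hL1 (by linarith)
    have h4 : B * L = (1 + Real.log b) * L + A * L := by rw [hB]; ring
    linarith
  have hKl0 : 0 ≤ 1 + Real.log K := by
    have : 0 ≤ Real.log K := Real.log_nonneg (by exact_mod_cast hK1)
    linarith
  set I := Finset.Icc 1 M ×ˢ Finset.Icc 1 K with hI
  set D := ∑ i ∈ I, ∑ j ∈ I, gterm a b i.1 j.1 i.2 j.2 with hD
  set S := ∑ i ∈ I, ∑ j ∈ I, ww a b i * ww a b j * (Im a b T T₀ i j + Ip a b T T₀ i j) with hS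
  have hterm : ∀ i ∈ I, ∀ j ∈ I,
      |ww a b i * ww a b j * (Im a b T T₀ i j + Ip a b T T₀ i j) - gterm a b i.1 j.1 i.2 j.2 * J| ≤
        κ * T * EE a b V (i.1, j.1) (i.2, j.2) +
        κ' * T * (1 / ((i.1:ℝ) * j.1) * (1 / ((i.2:ℝ) * j.2))) := by
    rintro ⟨h1, r1⟩ hi ⟨h2, r2⟩ hj
    simp only [hI, Finset.mem_product, Finset.mem_Icc] at hi hj
    obtain ⟨⟨p1, -⟩, ⟨p3, -⟩⟩ := hi
    obtain ⟨⟨p2, -⟩, ⟨p4, -⟩⟩ := hj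
    have hip := Ip_bd a b ha hb T T₀ hT hT0 hTT h1 h2 r1 r2 p1 p2 p3 p4
    have hw := mul_nonneg (ww_nonneg a b (h1, r1)) (ww_nonneg a b (h2, r2))
    rw [← abs_of_nonneg hw, ← abs_mul] at hip
    have hEE := EE_nonneg a b V hV0.le (h1, h2) (r1, r2)
    simp only
    rw [gterm_eq]
    by_cases heq : h1 ^ a * r1 ^ b = h2 ^ a * r2 ^ b
    · rw [if_pos heq]
      have hIJ : Im a b T T₀ (h1, r1) (h2, r2) = J := by
        simp only [Im, (nn_eq_iff a b ha h1 h2 r1 r2).mpr heq]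
        simp [hJ, hs]
      rw [hIJ]
      have : ww a b (h1, r1) * ww a b (h2, r2) * (J + Ip a b T T₀ (h1, r1) (h2, r2)) -
        ww a b (h1, r1) * ww a b (h2, r2) * J = ww a b (h1, r1) * ww a b (h2, r2) * Ip a b T T₀ (h1, r1) (h2, r2) := by ring
      rw [this]
      have : 0 ≤ κ * T * EE a b V (h1, h2) (r1, r2) := by positivity
      exact hip.trans (by linarith)
    · rw [if_neg heq, zero_mul, sub_zero, mul_add]
      have him := Im_off a b ha hb T T₀ hT hT0 hTT h1 h2 r1 r2 p1 p2 p3 p4 heq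
      rw [← abs_of_nonneg hw, ← abs_mul] at him
      exact (abs_add_le _ _).trans (add_le_add him hip)
  have hSD : |S - D * J| ≤ κ * T * (C3 * (B * L) ^ 3 * (V ^ ((((a + b : ℕ) : ℝ) - 2) / (((a + b : ℕ) : ℝ) - 1)) + B * L))
      + κ' * T * (B * L) ^ 4 := by
    have e : S - D * J = ∑ i ∈ I, ∑ j ∈ I, (ww a b i * ww a b j * (Im a b T T₀ i j + Ip a b T T₀ i j) -
        gterm a b i.1 j.1 i.2 j.2 * J) := by
      simp only [hS, hD, Finset.sum_sub_distrib, Finset.sum_mul]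
    rw [e]
    calc _ ≤ ∑ i ∈ I, ∑ j ∈ I, (κ * T * EE a b V (i.1, j.1) (i.2, j.2) +
        κ' * T * (1 / ((i.1:ℝ) * j.1) * (1 / ((i.2:ℝ) * j.2)))) := by
          refine (Finset.abs_sum_le_sum_abs _ _).trans (Finset.sum_le_sum fun i hi => ?_)
          exact (Finset.abs_sum_le_sum_abs _ _).trans (Finset.sum_le_sum fun j hj => hterm i hi j hj)
      _ ≤ ∑ x ∈ Sq K, ∑ y ∈ Sq K, (κ * T * EE a b V x y +
        κ' * T * (1 / ((x.1:ℝ) * x.2) * (1 / ((y.1:ℝ) * y.2)))) :=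
          sum_reorder (fun x y => κ * T * EE a b V x y +
            κ' * T * (1 / ((x.1:ℝ) * x.2) * (1 / ((y.1:ℝ) * y.2)))) (fun x y => by
              have hEE := EE_nonneg a b V hV0.le x y
              positivity) M K hMK
      _ = κ * T * (∑ x ∈ Sq K, ∑ y ∈ Sq K, EE a b V x y) +
          κ' * T * ((∑ x ∈ Sq K, 1 / ((x.1:ℝ) * x.2)) * (∑ y ∈ Sq K, 1 / ((y.1:ℝ) * y.2))) := by
        rw [Finset.sum_mul_sum]
        simp only [Finset.sum_add_distrib, Finset.mul_sum]
      _ ≤ κ * T * (C3 * (1 + Real.log K) ^ 3 * (V ^ ((((a + b : ℕ) : ℝ) - 2) / (((a + b : ℕ) : ℝ) - 1)) + (1 + Real.log K)))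
          + κ' * T * ((1 + Real.log K) ^ 2 * (1 + Real.log K) ^ 2) := by
        have h1 := off K V hK1 hV0
        have h2 := sum_inv_Sq K
        have h3 : 0 ≤ ∑ x ∈ Sq K, 1 / ((x.1:ℝ) * x.2) := Finset.sum_nonneg fun _ _ => by positivity
        gcongr
      _ ≤ _ := by
        rw [← pow_add]
        gcongr
  have hsc : (((a + b : ℕ) : ℝ)) = s := by push_cast; rfl
  rw [hsc] at hSD
  have hfrac : (a:ℝ) / (b * s * (s - 1)) ≤ 1 / s * (1 / (s - 1)) := by
    have hs1 : 0 < s - 1 := by linarith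
    have hbp : (0:ℝ) < b := by linarith
    rw [div_mul_div_comm, one_mul, div_le_div_iff₀ (by positivity) (by positivity)]
    have : 0 ≤ s * (s - 1) := by positivity
    nlinarith
  have hTW : T ≤ W := by
    calc T = T ^ (1:ℝ) := (Real.rpow_one T).symm
      _ ≤ W := by
        apply Real.rpow_le_rpow_of_exponent_le hT1
        have : 1 / s * (1 / (s - 1)) ≤ 1 / s * 1 := by
          gcongr
          rw [div_le_one (by linarith)]; linarith
        linarith
  have hTVW : T * V ^ ((s - 2) / (s - 1)) ≤ W := by
    have : T * V ^ ((s - 2) / (s - 1)) = T ^ (1 + 1 / s * ((s - 2) / (s - 1))) := by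
      rw [Real.rpow_add hT, Real.rpow_one, hV, ← Real.rpow_mul hT.le]
    rw [this]
    apply Real.rpow_le_rpow_of_exponent_le hT1
    have : 1 / s * ((s - 2) / (s - 1)) = 1 / s - 1 / s * (1 / (s - 1)) := by
      have : s - 1 ≠ 0 := by linarith
      field_simp
      ring
    linarith
  have hSD2 : |S - D * J| ≤ E1 * (W * L ^ 4) := by
    refine hSD.trans ?_
    have h34 : L ^ 3 ≤ L ^ 4 := pow_le_pow_right₀ hL1 (by norm_num)
    have e : κ * T * (C3 * (B * L) ^ 3 * (V ^ ((s - 2) / (s - 1)) + B * L)) + κ' * T * (B * L) ^ 4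
      = κ * C3 * B ^ 3 * ((T * V ^ ((s - 2) / (s - 1))) * L ^ 3 + B * (T * L ^ 4)) + κ' * B ^ 4 * (T * L ^ 4) := by ring
    rw [e]
    calc _ ≤ κ * C3 * B ^ 3 * (W * L ^ 4 + B * (W * L ^ 4)) + κ' * B ^ 4 * (W * L ^ 4) := by
          gcongr
      _ = _ := by rw [hE1]; ring
  have htail := tail H hH
  set Y := H ^ (-(a : ℝ) / (2 * s)) with hY
  have hY0 : 0 ≤ Y := by positivity
  have hT1V : T ^ (1 + 1 / s) = T * V := by rw [Real.rpow_add hT, Real.rpow_one]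
  rw [hT1V]
  have hDG : |(D - Gab a b) * J| ≤ 2 * C4 * (T * V * Y * L ^ 2) := by
    rw [abs_mul]
    calc |D - Gab a b| * |J| ≤ (C4 * Y) * (2 * T * V) := by
          apply mul_le_mul htail hJb (abs_nonneg _) (by positivity)
      _ = 2 * C4 * (T * V * Y * 1) := by ring
      _ ≤ _ := by
        gcongr
        exact one_le_pow₀ hL1
  have e : c0 * S - c0 * Gab a b * J = c0 * ((S - D * J) + (D - Gab a b) * J) := by ring
  rw [e, abs_mul, abs_of_nonneg hc00]
  have hX1 : 0 ≤ T * V * Y * L ^ 2 := by positivity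
  have hX2 : 0 ≤ W * L ^ 4 := by positivity
  calc c0 * |(S - D * J) + (D - Gab a b) * J| ≤ c0 * (E1 * (W * L ^ 4) + 2 * C4 * (T * V * Y * L ^ 2)) := by
        gcongr
        exact (abs_add_le _ _).trans (add_le_add hSD2 hDG)
    _ ≤ c0 * ((E1 + 2 * C4) * (T * V * Y * L ^ 2 + W * L ^ 4)) := by
        gcongr
        have t1 := mul_nonneg hE10 hX1
        have t2 := mul_nonneg hC4 hX2
        linarith
    _ ≤ _ := by
        rw [add_mul (c0 * (E1 + 2 * C4)), ← mul_assoc, one_mul]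
        linarith

theorem mean_square_DeltaStar_coprime_integers (a b : ℕ) (ha : 1 ≤ a) (hab : a < b)
    (hcop : Nat.gcd a b = 1) (A : ℝ) (hA : 0 < A) :
    ∃ C > (0 : ℝ), ∀ T T₀ H : ℝ, 10 ≤ T → 0 < T₀ → T₀ ≤ T →
      2 ≤ H → H ≤ T ^ A →
      |(∫ x in T..(T + T₀), (DeltaStar a b H x) ^ 2) -
          (c1 a b) ^ 2 / (2 * π ^ 2) * Gab a b *
            ∫ x in T..(T + T₀), x ^ (1 / ((a : ℝ) + b))| ≤
        C * (T ^ (1 + 1 / ((a : ℝ) + b)) * H ^ (-(a : ℝ) / (2 * ((a : ℝ) + b))) *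
            (Real.log T) ^ 2 +
          T ^ (1 + 1 / ((a : ℝ) + b) -
              (a : ℝ) / (b * ((a : ℝ) + b) * ((a : ℝ) + b - 1))) *
            (Real.log T) ^ 4) := by
  exact final_aux a b ha hab A hA
end

section
/- Let M ≥ 2 be a real number and let h₁, h₂, r₁, r₂ be positive integers with h₁ ≠ h₂, r₁ ≠ r₂, and h₁, h₂, r₁, r₂ ≤ M. Suppose that log(h₁/h₂) / log(r₁/r₂) = q/p for some positive integer p and nonzero integer q with gcd(p, |q|) = 1. Then p ≤ log M / log 2. -/
open Real

theorem exponent_denominator_bound (M : ℝ) (hM : 2 ≤ M)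
    (h₁ h₂ r₁ r₂ : ℕ+) (hne_h : h₁ ≠ h₂) (hne_r : r₁ ≠ r₂)
    (hh₁ : (h₁ : ℝ) ≤ M) (hh₂ : (h₂ : ℝ) ≤ M)
    (hr₁ : (r₁ : ℝ) ≤ M) (hr₂ : (r₂ : ℝ) ≤ M)
    (p : ℕ) (hp : 0 < p) (q : ℤ) (hq : q ≠ 0)
    (hcop : Nat.Coprime p q.natAbs)
    (hrel : Real.log ((h₁ : ℝ) / (h₂ : ℝ)) / Real.log ((r₁ : ℝ) / (r₂ : ℝ)) =
      (q : ℝ) / (p : ℝ)) :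
    (p : ℝ) ≤ Real.log M / Real.log 2 := by
  have a1 : 0 < (h₁ : ℕ) := h₁.pos
  have a2 : 0 < (h₂ : ℕ) := h₂.pos
  have b1 : 0 < (r₁ : ℕ) := r₁.pos
  have b2 : 0 < (r₂ : ℕ) := r₂.pos
  have hne : (r₁ : ℕ) ≠ (r₂ : ℕ) := fun h => hne_r (PNat.coe_injective h)
  generalize (h₁ : ℕ) = A at *
  generalize (h₂ : ℕ) = B at *
  generalize (r₁ : ℕ) = C at *
  generalize (r₂ : ℕ) = D at *
  have A0 : (0 : ℝ) < A := by exact_mod_cast a1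
  have B0 : (0 : ℝ) < B := by exact_mod_cast a2
  have C0 : (0 : ℝ) < C := by exact_mod_cast b1
  have D0 : (0 : ℝ) < D := by exact_mod_cast b2
  have hp0 : (p : ℝ) ≠ 0 := by positivity
  have hq0 : (q : ℝ) ≠ 0 := by exact_mod_cast hq
  have hlog : Real.log ((C : ℝ) / D) ≠ 0 := by
    intro h
    rw [h, div_zero] at hrel
    exact (div_ne_zero hq0 hp0) hrel.symm
  rw [div_eq_div_iff hlog hp0] at hrel
  have key : ((A : ℝ) / B) ^ p = ((C : ℝ) / D) ^ q := by
    apply Real.log_injOn_pos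
    · exact Set.mem_Ioi.2 (by positivity)
    · exact Set.mem_Ioi.2 (by positivity)
    · rw [Real.log_pow, Real.log_zpow]; linarith
  have keyQ : ((A : ℚ) / B) ^ p = ((C : ℚ) / D) ^ q := by
    apply Rat.cast_injective (α := ℝ)
    push_cast
    exact key
  have C0' : (0 : ℚ) < C := by exact_mod_cast b1
  have D0' : (0 : ℚ) < D := by exact_mod_cast b2
  have A0' : (0 : ℚ) < A := by exact_mod_cast a1
  have B0' : (0 : ℚ) < B := by exact_mod_cast a2
  have hx0 : (0 : ℚ) < (C : ℚ) / D := by positivity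
  have hH0 : (0 : ℚ) < (A : ℚ) / B := by positivity
  have hx1 : (C : ℚ) / D ≠ 1 := by
    intro h
    rw [div_eq_one_iff_eq D0'.ne'] at h
    exact hne (by exact_mod_cast h)
  have hnum : ((C : ℚ) / D).num ∣ (C : ℤ) := by
    have := Rat.num_dvd (C : ℤ) (b := (D : ℤ)) (by exact_mod_cast b2.ne')
    simpa [Rat.divInt_eq_div] using this
  have hden : (((C : ℚ) / D).den : ℤ) ∣ (D : ℤ) := by
    have := Rat.den_dvd (C : ℤ) (D : ℤ)
    simpa [Rat.divInt_eq_div] using this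
  generalize (C : ℚ) / D = x at *
  generalize (A : ℚ) / B = H at *
  have hc : IsCoprime (p : ℤ) q := by
    rw [Int.isCoprime_iff_gcd_eq_one]; simpa [Int.gcd] using hcop
  obtain ⟨u, v, huv⟩ := hc
  obtain ⟨y, hy⟩ : ∃ y, y = x ^ u * H ^ v := ⟨_, rfl⟩
  have hy0 : 0 < y := by rw [hy]; positivity
  have hyx : y ^ p = x := by
    have e1 : (H ^ v) ^ p = x ^ (v * q) := by
      rw [← zpow_natCast, ← zpow_mul, mul_comm, zpow_mul, zpow_natCast, keyQ, ← zpow_mul, mul_comm]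
    rw [hy, mul_pow, e1, ← zpow_natCast, ← zpow_mul, ← zpow_add₀ hx0.ne', huv, zpow_one]
  have hy1 : y ≠ 1 := by
    rintro rfl
    exact hx1 (by rw [← hyx, one_pow])
  have fin : ∀ n : ℕ, 0 < n → (n : ℝ) ≤ M → ∀ a : ℕ, 2 ≤ a → a ^ p ∣ n →
      (p : ℝ) ≤ Real.log M / Real.log 2 := by
    intro n hn hnM a ha hd
    rw [le_div_iff₀ (Real.log_pos one_lt_two), ← Real.log_pow]
    apply Real.log_le_log (by positivity)
    have h1 : 2 ^ p ≤ n := (Nat.pow_le_pow_left ha p).trans (Nat.le_of_dvd hn hd)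
    have h2 : ((2 : ℝ)) ^ p ≤ n := by exact_mod_cast h1
    exact h2.trans hnM
  rw [← hyx, Rat.num_pow] at hnum
  rw [← hyx, Rat.den_pow] at hden
  have hnp : 0 < y.num := Rat.num_pos.2 hy0
  by_cases hd : 2 ≤ y.den
  · exact fin D b2 hr₂ y.den hd (by exact_mod_cast hden)
  · have hd1 : y.den = 1 := by have := y.den_pos; omega
    have hn1 : y.num ≠ 1 := fun h => hy1 (by rw [← Rat.num_div_den y, h, hd1]; simp)
    obtain ⟨a, ha⟩ := Int.eq_ofNat_of_zero_le hnp.le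
    refine fin C b1 hr₁ a (by omega) ?_
    rw [ha] at hnum
    exact_mod_cast hnum
end
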